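/- Let Σ(A,B,C,G) be a system node with finite-dimensional input space U and finite-dimensional output space Y. Then Σ(A,B,C,G) is C^∞-BIBO stable if and only if there exists a Borel measure h of bounded total variation on [0,∞) with values in the d_Y × d_U complex matrices whose Laplace transform satisfies ĥ = G on the half-plane C_{ω(T)} = {s ∈ ℂ : Re s > ω(T)}, where ω(T) is the growth bound of the semigroup generated by A. -/

import Mathlib

/-- A bundled complex Banach space (declared before `open MeasureTheory`, whose
notations interfere with instance-binder fields in structures). -/
structure CplxBanach where
  carrier : Type
  [nacg : NormedAddCommGroup carrier]
  [nsp : NormedSpace ℂ carrier]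
  [cs : CompleteSpace carrier]

attribute [instance] CplxBanach.nacg CplxBanach.nsp CplxBanach.cs

/-- A bundled complex Hilbert space. -/
structure CplxHilbert where
  carrier : Type
  [nacg : NormedAddCommGroup carrier]
  [ips : InnerProductSpace ℂ carrier]
  [cs : CompleteSpace carrier]

attribute [instance] CplxHilbert.nacg CplxHilbert.ips CplxHilbert.cs

open MeasureTheory Set
open scoped ENNReal NNReal Topology

noncomputable section

/-- A strongly continuous semigroup of bounded linear operators on a complex Banach space. -/
structure C0Semigroup (X : Type*) [NormedAddCommGroup X] [NormedSpace ℂ X] where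
  T : ℝ → X →L[ℂ] X
  map_zero : T 0 = ContinuousLinearMap.id ℂ X
  map_add : ∀ s t : ℝ, 0 ≤ s → 0 ≤ t → T (s + t) = (T s).comp (T t)
  strongly_continuous : ∀ x : X, ContinuousOn (fun t => T t x) (Set.Ici 0)

namespace C0Semigroup

variable {X : Type*} [NormedAddCommGroup X] [NormedSpace ℂ X]

/-- The growth bound `ω(T)` of a strongly continuous semigroup. -/
def growthBound (S : C0Semigroup X) : ℝ :=
  sInf {w : ℝ | ∃ M : ℝ, ∀ t : ℝ, 0 ≤ t → ‖S.T t‖ ≤ M * Real.exp (w * t)}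

/-- Exponential stability of a strongly continuous semigroup. -/
def ExpStable (S : C0Semigroup X) : Prop :=
  ∃ ε : ℝ, 0 < ε ∧ ∃ M : ℝ, ∀ t : ℝ, 0 ≤ t → ‖S.T t‖ ≤ M * Real.exp (-ε * t)

/-- The semigroup is analytic: it extends analytically to an open sector around the
positive real axis, the extension satisfying the semigroup property on the sector. -/
def IsAnalytic (S : C0Semigroup X) : Prop :=
  ∃ θ : ℝ, θ ∈ Set.Ioo 0 (Real.pi / 2) ∧ ∃ F : ℂ → X →L[ℂ] X,
    DifferentiableOn ℂ F {z : ℂ | z ≠ 0 ∧ |Complex.arg z| < θ} ∧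
    (∀ t : ℝ, 0 < t → F t = S.T t) ∧
    (∀ z w : ℂ, (z ≠ 0 ∧ |Complex.arg z| < θ) → (w ≠ 0 ∧ |Complex.arg w| < θ) →
      F (z + w) = (F z).comp (F w))

/-- The fractional power `(-A)^{-γ}` of the negative generator of an exponentially
stable semigroup, defined through the standard integral formula
`(-A)^{-γ} = Γ(γ)⁻¹ ∫_0^∞ t^{γ-1} T(t) dt` (and the identity for `γ = 0`). -/
def negAPow (S : C0Semigroup X) (γ : ℝ) : X →L[ℂ] X :=
  if γ = 0 then ContinuousLinearMap.id ℂ X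
  else (Real.Gamma γ)⁻¹ • ∫ t in Set.Ioi (0:ℝ), t ^ (γ - 1) • S.T t

end C0Semigroup

/-- A system node `Σ(A,B,C,G)` on the Banach spaces `(U, X, Y)`, in the sense of Staffans.
The extrapolation space `X_{-1}` is given as the space `Xm1` together with a dense
continuous embedding `ι : X → X_{-1}`; `Am1 : X → X_{-1}` is the extension
`A_{-1}` of the generator restricted to `X` (which is bounded from `X` to `X_{-1}`);
the domain of `A` is the set of `x ∈ X` with `A_{-1} x ∈ X`.  `R s` is the resolvent
`(s - A_{-1})^{-1} : X_{-1} → X`, defined (as specified by `R_right`, `R_left`) for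
`Re s > ω(T)`.  `B : U → X_{-1}` is the control operator and `Cop` is the observation
operator `C : X_1 → Y`, encoded as a map on all of `X` that is linear and
`X_1`-bounded on the domain of `A`.  `G` is the transfer function. -/
structure SystemNode (U : Type*) (X : Type*) (Xm1 : Type*) (Y : Type*)
    [NormedAddCommGroup U] [NormedSpace ℂ U]
    [NormedAddCommGroup X] [NormedSpace ℂ X]
    [NormedAddCommGroup Xm1] [NormedSpace ℂ Xm1]
    [NormedAddCommGroup Y] [NormedSpace ℂ Y] where
  S : C0Semigroup X
  Sm1 : C0Semigroup Xm1
  ι : X →L[ℂ] Xm1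
  ι_injective : Function.Injective (fun x : X => ι x)
  ι_dense : DenseRange (fun x : X => ι x)
  semigroup_compat : ∀ t : ℝ, 0 ≤ t → ∀ x : X, Sm1.T t (ι x) = ι (S.T t x)
  Am1 : X →L[ℂ] Xm1
  generator : ∀ x : X, ∀ t : ℝ, 0 ≤ t →
    HasDerivWithinAt (fun τ : ℝ => ι (S.T τ x)) (Am1 (S.T t x)) (Set.Ici 0) t
  B : U →L[ℂ] Xm1
  Cop : X → Y
  Cop_add : ∀ x₁ x₂ : X, (∃ z : X, Am1 x₁ = ι z) → (∃ z : X, Am1 x₂ = ι z) →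
    Cop (x₁ + x₂) = Cop x₁ + Cop x₂
  Cop_smul : ∀ (a : ℂ) (x : X), (∃ z : X, Am1 x = ι z) → Cop (a • x) = a • Cop x
  Cop_bound : ∃ M : ℝ, ∀ x z : X, Am1 x = ι z → ‖Cop x‖ ≤ M * (‖x‖ + ‖z‖)
  R : ℂ → Xm1 →L[ℂ] X
  R_right : ∀ s : ℂ, S.growthBound < s.re → ∀ w : Xm1, s • ι (R s w) - Am1 (R s w) = w
  R_left : ∀ s : ℂ, S.growthBound < s.re → ∀ x : X, R s (s • ι x - Am1 x) = x
  G : ℂ → U →L[ℂ] Y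
  G_analytic : DifferentiableOn ℂ (fun s => G s) {s : ℂ | S.growthBound < s.re}
  G_shift : ∀ α β : ℂ, S.growthBound < α.re → S.growthBound < β.re → ∀ u : U,
    G α u - G β u = Cop (R α (B u) - R β (B u))

namespace SystemNode

variable {U X Xm1 Y : Type*}
  [NormedAddCommGroup U] [NormedSpace ℂ U]
  [NormedAddCommGroup X] [NormedSpace ℂ X]
  [NormedAddCommGroup Xm1] [NormedSpace ℂ Xm1]
  [NormedAddCommGroup Y] [NormedSpace ℂ Y]

/-- The domain of the generator `A`: those `x ∈ X` with `A_{-1} x ∈ X`. -/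
def domA (sys : SystemNode U X Xm1 Y) : Set X := {x : X | ∃ z : X, sys.Am1 x = sys.ι z}

/-- A fixed point in the half-plane of analyticity of the transfer function. -/
def betaPt (sys : SystemNode U X Xm1 Y) : ℂ := ((sys.S.growthBound + 1 : ℝ) : ℂ)

/-- The combined observation/feedthrough operator
`C&D (x,u) = C[x - (β - A)⁻¹ B u] + G(β) u`. -/
def CD (sys : SystemNode U X Xm1 Y) (x : X) (u : U) : Y :=
  sys.Cop (x - sys.R sys.betaPt (sys.B u)) + sys.G sys.betaPt u

/-- The pair `(x,u)` belongs to the domain of the combined operator `C&D`,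
i.e. `A_{-1} x + B u ∈ X`. -/
def memCD (sys : SystemNode U X Xm1 Y) (x : X) (u : U) : Prop :=
  ∃ z : X, sys.Am1 x + sys.B u = sys.ι z

/-- A classical solution `(u,x,y)` of the system node on `[0,∞)`:
`u, y` continuous, `x` continuously differentiable with
`ẋ(t) = A x(t) + B u(t)` (in particular `(x(t),u(t)) ∈ D(C&D)`) and
`y(t) = C&D (x(t),u(t))` for all `t ≥ 0`. -/
def IsClassicalSolution (sys : SystemNode U X Xm1 Y)
    (u : ℝ → U) (x : ℝ → X) (y : ℝ → Y) : Prop :=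
  ContinuousOn u (Set.Ici 0) ∧ ContinuousOn y (Set.Ici 0) ∧
  (∃ x' : ℝ → X, ContinuousOn x' (Set.Ici 0) ∧
    (∀ t ∈ Set.Ici (0:ℝ), HasDerivWithinAt x (x' t) (Set.Ici 0) t) ∧
    (∀ t ∈ Set.Ici (0:ℝ), sys.Am1 (x t) + sys.B (u t) = sys.ι (x' t))) ∧
  (∀ t ∈ Set.Ici (0:ℝ), y t = sys.CD (x t) (u t))

/-- `C^∞`-BIBO stability: there is `c > 0` such that every classical solution with
zero initial state and smooth input compactly supported in `(0,∞)` has output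
bounded by `c` times the sup-norm of the input. -/
def CInfBIBOStable (sys : SystemNode U X Xm1 Y) : Prop :=
  ∃ c : ℝ, 0 < c ∧ ∀ (u : ℝ → U) (x : ℝ → X) (y : ℝ → Y),
    sys.IsClassicalSolution u x y → x 0 = 0 →
    ContDiff ℝ (⊤ : ℕ∞) u → HasCompactSupport u → tsupport u ⊆ Set.Ioi 0 →
    ∀ M : ℝ, (∀ s : ℝ, ‖u s‖ ≤ M) → ∀ t : ℝ, 0 ≤ t → ‖y t‖ ≤ c * M

/-- The state part of a generalised solution in the distributional sense:
`u ∈ L¹_loc`, `x` continuous `X_{-1}`-valued, given by the variation of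
constants formula with initial state `x₀ ∈ X`. -/
def IsMildState (sys : SystemNode U X Xm1 Y) (x₀ : X) (u : ℝ → U) (xs : ℝ → Xm1) : Prop :=
  MeasureTheory.LocallyIntegrableOn u (Set.Ici 0) ∧
  ContinuousOn xs (Set.Ici 0) ∧
  ∀ t : ℝ, 0 ≤ t →
    IntervalIntegrable (fun s => sys.Sm1.T (t - s) (sys.B (u s))) MeasureTheory.volume 0 t ∧
    xs t = sys.Sm1.T t (sys.ι x₀) + ∫ s in (0:ℝ)..t, sys.Sm1.T (t - s) (sys.B (u s))

/-- The output part of a generalised solution in the distributional sense: the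
(locally integrable representative of the) `Y`-valued distribution
`y = d²/dt² ( C&D ∫_0^t (t-s) (x(s), u(s)) ds )`. -/
def IsGenOutput (sys : SystemNode U X Xm1 Y) (u : ℝ → U) (xs : ℝ → Xm1) (y : ℝ → Y) : Prop :=
  MeasureTheory.LocallyIntegrableOn y (Set.Ici 0) ∧
  ∃ (K : ℝ → X) (L : ℝ → U),
    (∀ t : ℝ, 0 ≤ t → sys.ι (K t) = ∫ s in (0:ℝ)..t, (t - s) • xs s) ∧
    (∀ t : ℝ, 0 ≤ t → L t = ∫ s in (0:ℝ)..t, (t - s) • u s) ∧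
    (∀ t : ℝ, 0 ≤ t → sys.memCD (K t) (L t)) ∧
    (∀ φ : ℝ → ℝ, ContDiff ℝ (⊤ : ℕ∞) φ → HasCompactSupport φ → tsupport φ ⊆ Set.Ioi 0 →
      ∫ t in Set.Ioi (0:ℝ), deriv (deriv φ) t • sys.CD (K t) (L t) =
        ∫ t in Set.Ioi (0:ℝ), φ t • y t)

/-- A generalised solution in the distributional sense. -/
def IsGeneralizedSolution (sys : SystemNode U X Xm1 Y) (x₀ : X)
    (u : ℝ → U) (xs : ℝ → Xm1) (y : ℝ → Y) : Prop :=
  sys.IsMildState x₀ u xs ∧ sys.IsGenOutput u xs y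

/-- `L^∞`-BIBO stability: there is `c > 0` such that for every generalised solution in
the distributional sense with zero initial state and locally essentially bounded input,
the output is represented by a locally essentially bounded function with
`‖y‖_{L^∞([0,t])} ≤ c ‖u‖_{L^∞([0,t])}` for all `t > 0`. -/
def LInfBIBOStable (sys : SystemNode U X Xm1 Y) : Prop :=
  ∃ c : ℝ, 0 < c ∧ ∀ (u : ℝ → U) (xs : ℝ → Xm1),
    sys.IsMildState 0 u xs →
    (∀ t : ℝ, 0 < t → ∃ M : ℝ,
      ∀ᵐ s ∂(MeasureTheory.volume.restrict (Set.Ioc (0:ℝ) t)), ‖u s‖ ≤ M) →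
    ∃ y : ℝ → Y, sys.IsGenOutput u xs y ∧
      ∀ t : ℝ, 0 < t → ∀ M : ℝ,
        (∀ᵐ s ∂(MeasureTheory.volume.restrict (Set.Ioc (0:ℝ) t)), ‖u s‖ ≤ M) →
        (∀ᵐ s ∂(MeasureTheory.volume.restrict (Set.Ioc (0:ℝ) t)), ‖y s‖ ≤ c * M)

/-- `L^p`-control-admissibility of the control operator `B`. -/
def ControlAdmissible (sys : SystemNode U X Xm1 Y) (p : ℝ≥0∞) : Prop :=
  ∀ t : ℝ, 0 < t → ∃ M : ℝ, ∀ u : ℝ → U,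
    IntervalIntegrable (fun s => sys.Sm1.T (t - s) (sys.B (u s))) MeasureTheory.volume 0 t →
    ∃ x : X, sys.ι x = ∫ s in (0:ℝ)..t, sys.Sm1.T (t - s) (sys.B (u s)) ∧
      ‖x‖ ≤ M * (eLpNorm u p (MeasureTheory.volume.restrict (Set.Ioc (0:ℝ) t))).toReal

/-- Infinite-time `L^p`-control-admissibility: the admissibility constant can be chosen
uniformly in `t`. -/
def InfTimeControlAdmissible (sys : SystemNode U X Xm1 Y) (p : ℝ≥0∞) : Prop :=
  ∃ M : ℝ, ∀ t : ℝ, 0 < t → ∀ u : ℝ → U,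
    IntervalIntegrable (fun s => sys.Sm1.T (t - s) (sys.B (u s))) MeasureTheory.volume 0 t →
    ∃ x : X, sys.ι x = ∫ s in (0:ℝ)..t, sys.Sm1.T (t - s) (sys.B (u s)) ∧
      ‖x‖ ≤ M * (eLpNorm u p (MeasureTheory.volume.restrict (Set.Ioc (0:ℝ) t))).toReal

/-- `L^p`-observation-admissibility of the observation operator `C`. -/
def ObservationAdmissible (sys : SystemNode U X Xm1 Y) (p : ℝ≥0∞) : Prop :=
  ∃ t : ℝ, 0 < t ∧ ∃ M : ℝ, ∀ x z : X, sys.Am1 x = sys.ι z →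
    (eLpNorm (fun s : ℝ => sys.Cop (sys.S.T s x)) p
      (MeasureTheory.volume.restrict (Set.Ioc (0:ℝ) t))).toReal ≤ M * ‖x‖

/-- `L²`-well-posedness of a system node: `B` and `C` are `L²`-admissible and the
transfer function is bounded on some right half-plane. -/
def L2WellPosed (sys : SystemNode U X Xm1 Y) : Prop :=
  sys.ControlAdmissible 2 ∧ sys.ObservationAdmissible 2 ∧
  ∃ w : ℝ, sys.S.growthBound ≤ w ∧ ∃ M : ℝ, ∀ s : ℂ, w < s.re → ‖sys.G s‖ ≤ M

end SystemNode

/-- A (matrix/operator valued) Borel measure of bounded total variation on `[0,∞)`,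
encoded through its polar decomposition: a finite positive measure `μ` supported on
`[0,∞)` together with a density `g` of norm one. -/
structure BVMeasure (U Y : Type*) [NormedAddCommGroup U] [NormedSpace ℂ U]
    [NormedAddCommGroup Y] [NormedSpace ℂ Y] where
  μ : MeasureTheory.Measure ℝ
  finite : MeasureTheory.IsFiniteMeasure μ
  supported : μ (Set.Iio 0) = 0
  g : ℝ → U →L[ℂ] Y
  g_meas : MeasureTheory.AEStronglyMeasurable g μ
  g_norm : ∀ᵐ t ∂μ, ‖g t‖ = 1

namespace BVMeasure

variable {U Y : Type*} [NormedAddCommGroup U] [NormedSpace ℂ U]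
  [NormedAddCommGroup Y] [NormedSpace ℂ Y]

/-- The total variation `‖h‖_M` of the measure. -/
def var (h : BVMeasure U Y) : ℝ := (h.μ Set.univ).toReal

/-- The Laplace transform `ĥ(s) u = ∫ e^{-st} dh(t) u`. -/
def laplace (h : BVMeasure U Y) (s : ℂ) (u : U) : Y :=
  ∫ t, Complex.exp (-(s * t)) • (h.g t u) ∂h.μ

/-- The convolution `(h ∗ u)(t) = ∫_{[0,t]} dh(s) u(t - s)`. -/
def conv (h : BVMeasure U Y) (u : ℝ → U) (t : ℝ) : Y :=
  ∫ s in Set.Icc 0 t, (h.g s) (u (t - s)) ∂h.μ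

end BVMeasure

/-- The Laplace transform of `h` coincides with the transfer function of the node on
the half-plane `ℂ_{ω(T)}` (on `ℂ_{ω(T)} ∩ ℂ_0`, identifying `ĥ` with its analytic
continuation). -/
def LaplaceMatches {U X Xm1 Y : Type*}
    [NormedAddCommGroup U] [NormedSpace ℂ U]
    [NormedAddCommGroup X] [NormedSpace ℂ X]
    [NormedAddCommGroup Xm1] [NormedSpace ℂ Xm1]
    [NormedAddCommGroup Y] [NormedSpace ℂ Y]
    (sys : SystemNode U X Xm1 Y) (h : BVMeasure U Y) : Prop :=
  ∀ s : ℂ, sys.S.growthBound < s.re → 0 ≤ s.re → ∀ u : U, h.laplace s u = sys.G s u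

/-- `sys'` is a system node for the multiplicatively perturbed triple `(AP, B, C)`. -/
def IsMultPerturbed {U X Xm1 Y : Type*}
    [NormedAddCommGroup U] [NormedSpace ℂ U]
    [NormedAddCommGroup X] [NormedSpace ℂ X]
    [NormedAddCommGroup Xm1] [NormedSpace ℂ Xm1]
    [NormedAddCommGroup Y] [NormedSpace ℂ Y]
    (sys sys' : SystemNode U X Xm1 Y) (P : X →L[ℂ] X) : Prop :=
  sys'.ι = sys.ι ∧ sys'.Am1 = sys.Am1.comp P ∧ sys'.B = sys.B ∧ sys'.Cop = sys.Cop

/-- `sys'` is a system node for the additively perturbed triple `(A + P, B, C)`. -/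
def IsAddPerturbed {U X Xm1 Y : Type*}
    [NormedAddCommGroup U] [NormedSpace ℂ U]
    [NormedAddCommGroup X] [NormedSpace ℂ X]
    [NormedAddCommGroup Xm1] [NormedSpace ℂ Xm1]
    [NormedAddCommGroup Y] [NormedSpace ℂ Y]
    (sys sys' : SystemNode U X Xm1 Y) (P : X →L[ℂ] X) : Prop :=
  sys'.ι = sys.ι ∧ sys'.Am1 = sys.Am1 + sys.ι.comp P ∧ sys'.B = sys.B ∧ sys'.Cop = sys.Cop

end

open MeasureTheory Set
open scoped ENNReal NNReal Topology

namespace C0Semigroup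
variable {X : Type*} [NormedAddCommGroup X] [NormedSpace ℂ X]

theorem locBdd [CompleteSpace X] (S : C0Semigroup X) (N : ℝ) :
    ∃ M, 0 ≤ M ∧ ∀ t, 0 ≤ t → t ≤ N → ‖S.T t‖ ≤ M := by
  obtain ⟨C, hC⟩ := banach_steinhaus (ι := Icc (0:ℝ) N) (g := fun t => S.T t) (fun x => by
    obtain ⟨C, hC⟩ := (isCompact_Icc (a := (0:ℝ)) (b := N)).exists_bound_of_continuousOn
      ((S.strongly_continuous x).mono (fun t ht => ht.1))
    exact ⟨C, fun i => hC i i.2⟩)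
  exact ⟨max C 0, le_max_right _ _, fun t h0 h1 => (hC ⟨t, h0, h1⟩).trans (le_max_left _ _)⟩

theorem growthSet_nonempty [CompleteSpace X] (S : C0Semigroup X) :
    {w : ℝ | ∃ M : ℝ, ∀ t : ℝ, 0 ≤ t → ‖S.T t‖ ≤ M * Real.exp (w * t)}.Nonempty := by
  obtain ⟨M0, -, hM0⟩ := S.locBdd 1
  set M := max M0 1
  have hM1 : 1 ≤ M := le_max_right _ _
  have hM : ∀ t, 0 ≤ t → t ≤ 1 → ‖S.T t‖ ≤ M := fun t h h' => (hM0 t h h').trans (le_max_left _ _)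
  have key : ∀ n : ℕ, ∀ t : ℝ, 0 ≤ t → t ≤ n + 1 → ‖S.T t‖ ≤ M ^ (n + 1) := by
    intro n
    induction n with
    | zero => intro t h h'; simpa using hM t h (by simpa using h')
    | succ n ih =>
      intro t h h'
      by_cases ht : t ≤ 1
      · exact (hM t h ht).trans (le_self_pow₀ hM1 (by simp))
      · push Not at ht
        have := S.map_add 1 (t - 1) zero_le_one (by linarith)
        rw [show 1 + (t - 1) = t by ring] at this
        rw [this, pow_succ']
        refine (ContinuousLinearMap.opNorm_comp_le _ _).trans ?_
        gcongr
        · exact hM 1 zero_le_one le_rfl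
        · exact ih (t - 1) (by linarith) (by push_cast at h'; linarith)
  refine ⟨Real.log M, M, fun t ht => ?_⟩
  have h1 := key ⌊t⌋₊ t ht (Nat.lt_floor_add_one t).le
  refine h1.trans ?_
  rw [pow_succ']
  gcongr
  rw [← Real.exp_log (show 0 < M by linarith), ← Real.exp_nat_mul, Real.exp_log (show 0 < M by linarith)]
  apply Real.exp_le_exp.2
  rw [mul_comm]
  exact mul_le_mul_of_nonneg_left (Nat.floor_le ht) (Real.log_nonneg hM1)

theorem growth [CompleteSpace X] (S : C0Semigroup X) {w : ℝ} (hw : S.growthBound < w) :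
    ∃ M : ℝ, 0 ≤ M ∧ ∃ w' < w, ∀ t : ℝ, 0 ≤ t → ‖S.T t‖ ≤ M * Real.exp (w' * t) := by
  obtain ⟨w', ⟨M, hM⟩, hlt⟩ := exists_lt_of_csInf_lt S.growthSet_nonempty hw
  refine ⟨M, ?_, w', hlt, hM⟩
  have := hM 0 le_rfl
  simp at this
  exact (norm_nonneg _).trans this

theorem jointCont [CompleteSpace X] (S : C0Semigroup X) :
    Continuous (fun p : ℝ × X => S.T (max p.1 0) p.2) := by
  rw [continuous_iff_continuousAt]
  rintro ⟨t0, x0⟩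
  obtain ⟨M, hM0, hM⟩ := S.locBdd (max t0 0 + 1)
  have h1 : Continuous (fun t : ℝ => S.T (max t 0) x0) :=
    (S.strongly_continuous x0).comp_continuous (by fun_prop) (fun t => mem_Ici.2 (le_max_right _ _))
  have h2 : Filter.Tendsto (fun p : ℝ × X => S.T (max p.1 0) (p.2 - x0)) (𝓝 (t0, x0)) (𝓝 0) := by
    apply squeeze_zero_norm' (a := fun p : ℝ × X => M * ‖p.2 - x0‖)
    · have : ∀ᶠ p : ℝ × X in 𝓝 (t0, x0), max p.1 0 < max t0 0 + 1 := by
        have hc : Continuous (fun p : ℝ × X => max p.1 0) := by fun_prop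
        exact hc.continuousAt.eventually_lt continuousAt_const (by simp)
      filter_upwards [this] with p hp
      exact (S.T _).le_of_opNorm_le (hM _ (le_max_right _ _) hp.le) _
    · have hc : Continuous (fun p : ℝ × X => M * ‖p.2 - x0‖) := by fun_prop
      simpa using hc.tendsto (t0, x0)
  have h3 : Filter.Tendsto (fun p : ℝ × X => S.T (max p.1 0) x0) (𝓝 (t0, x0))
      (𝓝 (S.T (max t0 0) x0)) :=
    (h1.comp continuous_fst).tendsto (t0, x0)
  have := h2.add h3
  simpa [ContinuousAt] using this

end C0Semigroup

namespace SystemNode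
variable {U X Xm1 Y : Type*}
  [NormedAddCommGroup U] [NormedSpace ℂ U]
  [NormedAddCommGroup X] [NormedSpace ℂ X]
  [NormedAddCommGroup Xm1] [NormedSpace ℂ Xm1]
  [NormedAddCommGroup Y] [NormedSpace ℂ Y]

theorem prodRule [CompleteSpace X] (sys : SystemNode U X Xm1 Y) {D : Set ℝ} {τ : ℝ → ℝ} {τ' : ℝ}
    {d : ℝ → X} {d' : X} {s : ℝ} (hs : s ∈ D) (hτD : MapsTo τ D (Ici 0))
    (hτ : HasDerivWithinAt τ τ' D s) (hd : HasDerivWithinAt d d' D s) :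
    HasDerivWithinAt (fun r => sys.ι (sys.S.T (τ r) (d r)))
      (τ' • sys.Am1 (sys.S.T (τ s) (d s)) + sys.ι (sys.S.T (τ s) d')) D s := by
  have h1 : HasDerivWithinAt (fun r => sys.ι (sys.S.T (τ r) (d s)))
      (τ' • sys.Am1 (sys.S.T (τ s) (d s))) D s :=
    (sys.generator (d s) (τ s) (hτD hs)).scomp s hτ hτD
  have h2 : HasDerivWithinAt (fun r => sys.ι (sys.S.T (τ r) (d r - d s)))
      (sys.ι (sys.S.T (τ s) d')) D s := by
    rw [hasDerivWithinAt_iff_tendsto_slope] at hd ⊢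
    have hc := (sys.ι.continuous.comp sys.S.jointCont).tendsto (τ s, d')
    have ht : Filter.Tendsto τ (𝓝[D \ {s}] s) (𝓝 (τ s)) :=
      hτ.continuousWithinAt.tendsto.mono_left (nhdsWithin_mono _ sdiff_subset)
    have := hc.comp (ht.prodMk_nhds hd)
    simp only [Function.comp_def, max_eq_left (show 0 ≤ τ s from hτD hs)] at this
    refine this.congr' ?_
    filter_upwards [self_mem_nhdsWithin] with r hr
    rw [max_eq_left (show 0 ≤ τ r from hτD hr.1)]
    simp [slope_def_module]
  have := h1.add h2
  refine this.congr_of_mem (fun r hr => ?_) hs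
  simp

theorem Am1_comm (sys : SystemNode U X Xm1 Y) {t : ℝ} (ht : 0 ≤ t) {x z : X}
    (h : sys.Am1 x = sys.ι z) : sys.Am1 (sys.S.T t x) = sys.ι (sys.S.T t z) := by
  have h1 := sys.generator (sys.S.T t x) 0 le_rfl
  have h2 := ((sys.Sm1.T t).restrictScalars ℝ).hasFDerivAt.comp_hasDerivWithinAt 0
    (sys.generator x 0 le_rfl)
  simp [sys.S.map_zero] at h1 h2
  rw [h, sys.semigroup_compat t ht] at h2
  refine (uniqueDiffWithinAt_Ici (0:ℝ)).eq_deriv _ h1 (h2.congr_of_mem (fun r hr => ?_) (by simp))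
  have e1 : sys.S.T r (sys.S.T t x) = sys.S.T t (sys.S.T r x) := by
    have a1 := DFunLike.congr_fun (sys.S.map_add _ _ hr ht) x
    have a2 := DFunLike.congr_fun (sys.S.map_add _ _ ht hr) x
    rw [add_comm] at a2
    exact a1.symm.trans a2
  simp only [Function.comp_def]
  rw [sys.semigroup_compat t ht, e1]

theorem unique_zero [CompleteSpace X] (sys : SystemNode U X Xm1 Y) {d d' : ℝ → X}
    (hd : ∀ t ∈ Ici (0:ℝ), HasDerivWithinAt d (d' t) (Ici 0) t)
    (hA : ∀ t ∈ Ici (0:ℝ), sys.Am1 (d t) = sys.ι (d' t)) (h0 : d 0 = 0) :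
    ∀ t, 0 ≤ t → d t = 0 := by
  intro t ht
  have hder : ∀ s ∈ Icc 0 t, HasDerivWithinAt (fun r => sys.ι (sys.S.T (t - r) (d r))) 0 (Icc 0 t) s := by
    intro s hs
    have h := sys.prodRule (D := Icc 0 t) (τ := fun r => t - r) (τ' := -1) hs
      (fun r hr => by simpa using hr.2)
      (by simpa using ((hasDerivAt_id s).const_sub t).hasDerivWithinAt)
      ((hd s hs.1).mono (fun r hr => hr.1))
    rw [sys.Am1_comm (by linarith [hs.2]) (hA s hs.1)] at h
    simpa using h
  have hc := constant_of_derivWithin_zero (fun s hs => (hder s hs).differentiableWithinAt)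
    (fun s hs => (hder s (Ico_subset_Icc_self hs)).derivWithin
      ((uniqueDiffOn_Icc (lt_of_le_of_lt hs.1 hs.2)) s (Ico_subset_Icc_self hs)))
  have := hc t ⟨ht, le_rfl⟩
  simp [h0, sys.S.map_zero] at this
  exact (map_eq_zero_iff _ sys.ι_injective).1 this

end SystemNode

open MeasureTheory Set
open scoped ENNReal NNReal Topology

namespace SystemNode
variable {U X Xm1 Y : Type*}
  [NormedAddCommGroup U] [NormedSpace ℂ U]
  [NormedAddCommGroup X] [NormedSpace ℂ X]
  [NormedAddCommGroup Xm1] [NormedSpace ℂ Xm1]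
  [NormedAddCommGroup Y] [NormedSpace ℂ Y]

theorem hbeta (sys : SystemNode U X Xm1 Y) : sys.S.growthBound < sys.betaPt.re := by
  simp [betaPt]

theorem Am1_R (sys : SystemNode U X Xm1 Y) {s : ℂ} (hs : sys.S.growthBound < s.re) (x : X) :
    sys.Am1 (sys.R s (sys.ι x)) = sys.ι (s • sys.R s (sys.ι x) - x) := by
  have := sys.R_right s hs (sys.ι x)
  simp only [map_sub, map_smul]
  rw [eq_sub_iff_add_eq, ← eq_sub_iff_add_eq']
  exact this.symm

/-- bounded version of `C R(β)` -/
noncomputable def C1 (sys : SystemNode U X Xm1 Y) : X →L[ℂ] Y :=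
  LinearMap.mkContinuousOfExistsBound
    { toFun := fun z => sys.Cop (sys.R sys.betaPt (sys.ι z))
      map_add' := fun x y => by
        rw [map_add, map_add]
        exact sys.Cop_add _ _ ⟨_, sys.Am1_R sys.hbeta x⟩ ⟨_, sys.Am1_R sys.hbeta y⟩
      map_smul' := fun a x => by
        rw [map_smul, map_smul]
        exact sys.Cop_smul _ _ ⟨_, sys.Am1_R sys.hbeta x⟩ }
    (by
      obtain ⟨M, hM⟩ := sys.Cop_bound
      refine ⟨|M| * (‖sys.R sys.betaPt‖ * ‖sys.ι‖ + (‖sys.betaPt‖ * (‖sys.R sys.betaPt‖ * ‖sys.ι‖) + 1)),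
        fun x => ?_⟩
      have h := hM _ _ (sys.Am1_R sys.hbeta x)
      have h1 : ‖sys.R sys.betaPt (sys.ι x)‖ ≤ ‖sys.R sys.betaPt‖ * ‖sys.ι‖ * ‖x‖ := by
        rw [mul_assoc]
        exact (sys.R sys.betaPt).le_opNorm_of_le (sys.ι.le_opNorm x)
      have h2 : ‖sys.betaPt • sys.R sys.betaPt (sys.ι x) - x‖ ≤
          ‖sys.betaPt‖ * (‖sys.R sys.betaPt‖ * ‖sys.ι‖ * ‖x‖) + ‖x‖ := by
        refine (norm_sub_le _ _).trans ?_
        rw [norm_smul]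
        gcongr
      calc _ ≤ M * (‖sys.R sys.betaPt (sys.ι x)‖ + ‖sys.betaPt • sys.R sys.betaPt (sys.ι x) - x‖) := h
        _ ≤ |M| * (‖sys.R sys.betaPt (sys.ι x)‖ + ‖sys.betaPt • sys.R sys.betaPt (sys.ι x) - x‖) := by
          gcongr; exact le_abs_self M
        _ ≤ |M| * (‖sys.R sys.betaPt‖ * ‖sys.ι‖ * ‖x‖ +
          (‖sys.betaPt‖ * (‖sys.R sys.betaPt‖ * ‖sys.ι‖ * ‖x‖) + ‖x‖)) := by gcongr
        _ = _ := by ring)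

theorem C1_apply (sys : SystemNode U X Xm1 Y) (z : X) :
    sys.C1 z = sys.Cop (sys.R sys.betaPt (sys.ι z)) := rfl

theorem Cop_eq (sys : SystemNode U X Xm1 Y) {w z : X} (h : sys.Am1 w = sys.ι z) :
    sys.Cop w = sys.C1 (sys.betaPt • w - z) := by
  rw [C1_apply]
  have := sys.R_left sys.betaPt sys.hbeta w
  rw [h] at this
  rw [map_sub, map_smul, this]

/-- `T(s) R(β) B` -/
noncomputable def P (sys : SystemNode U X Xm1 Y) (s : ℝ) : U →L[ℂ] X :=
  (sys.S.T s).comp ((sys.R sys.betaPt).comp sys.B)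

/-- `C R(β) T(s) R(β) B` -/
noncomputable def K (sys : SystemNode U X Xm1 Y) (s : ℝ) : U →L[ℂ] Y := sys.C1.comp (sys.P s)

theorem P_apply (sys : SystemNode U X Xm1 Y) (s : ℝ) (u : U) :
    sys.P s u = sys.S.T s (sys.R sys.betaPt (sys.B u)) := rfl

theorem continuous_P [FiniteDimensional ℂ U] [CompleteSpace X] (sys : SystemNode U X Xm1 Y) :
    Continuous (fun s => sys.P (max s 0)) := by
  rw [continuous_clm_apply]
  intro u
  exact sys.S.jointCont.comp (f := fun s : ℝ => (s, sys.R sys.betaPt (sys.B u))) (by fun_prop)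

theorem continuous_K [FiniteDimensional ℂ U] [CompleteSpace X] (sys : SystemNode U X Xm1 Y) :
    Continuous (fun s => sys.K (max s 0)) :=
  continuous_const.clm_comp sys.continuous_P

theorem K_growth [CompleteSpace X] (sys : SystemNode U X Xm1 Y) {w : ℝ}
    (hw : sys.S.growthBound < w) :
    ∃ M : ℝ, 0 ≤ M ∧ ∃ w' < w, ∀ t : ℝ, 0 ≤ t → ‖sys.K t‖ ≤ M * Real.exp (w' * t) := by
  obtain ⟨M, hM, w', hw', h⟩ := sys.S.growth hw
  refine ⟨‖sys.C1‖ * M * ‖(sys.R sys.betaPt).comp sys.B‖, by positivity, w', hw', fun t ht => ?_⟩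
  calc ‖sys.K t‖ ≤ ‖sys.C1‖ * ‖sys.P t‖ := ContinuousLinearMap.opNorm_comp_le _ _
    _ ≤ ‖sys.C1‖ * (‖sys.S.T t‖ * ‖(sys.R sys.betaPt).comp sys.B‖) := by
      gcongr; exact ContinuousLinearMap.opNorm_comp_le _ _
    _ ≤ ‖sys.C1‖ * ((M * Real.exp (w' * t)) * ‖(sys.R sys.betaPt).comp sys.B‖) := by
      gcongr; exact h t ht
    _ = _ := by ring

/-- convolution with P -/
noncomputable def W (sys : SystemNode U X Xm1 Y) (q : ℝ → U) (t : ℝ) : X :=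
  ∫ s in Ioi (0:ℝ), sys.P s (q (t - s))

theorem comp_sub_compact {q : ℝ → U} (hc : HasCompactSupport q) (t : ℝ) :
    HasCompactSupport (fun s => q (t - s)) :=
  hc.comp_homeomorph (Homeomorph.subLeft t)

theorem integrable_P [FiniteDimensional ℂ U] [CompleteSpace X] (sys : SystemNode U X Xm1 Y)
    {q : ℝ → U} (hq : Continuous q) (hc : HasCompactSupport q) :
    IntegrableOn (fun s => sys.P s (q s)) (Ioi 0) := by
  have : Integrable (fun s => sys.P (max s 0) (q s)) := by
    apply Continuous.integrable_of_hasCompactSupport (sys.continuous_P.clm_apply hq)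
    exact hc.mono' (fun s hs => subset_tsupport _ (fun h => hs (by simp [h])))
  refine this.integrableOn.congr_fun (fun s hs => ?_) measurableSet_Ioi
  simp [max_eq_left (le_of_lt (mem_Ioi.1 hs))]

theorem W_hasDeriv [FiniteDimensional ℂ U] [CompleteSpace X] (sys : SystemNode U X Xm1 Y)
    {q : ℝ → U} (hq : ContDiff ℝ 1 q) (hc : HasCompactSupport q) (t : ℝ) :
    HasDerivAt (sys.W q) (sys.W (deriv q) t) t := by
  let L : (U →L[ℂ] X) →L[ℝ] U →L[ℝ] X := ContinuousLinearMap.restrictScalarsL ℂ U X ℝ ℝ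
  let f : ℝ → (U →L[ℂ] X) := (Ioi (0:ℝ)).indicator (fun s => sys.P (max s 0))
  have hf : LocallyIntegrable f :=
    (sys.continuous_P.locallyIntegrable).indicator measurableSet_Ioi
  have key : ∀ q : ℝ → U, (convolution f q L volume) = sys.W q := by
    intro q
    ext t
    rw [W, ← integral_indicator measurableSet_Ioi, convolution]
    congr 1
    ext s
    by_cases hs : s ∈ Ioi (0:ℝ)
    · simp only [f, indicator_of_mem hs, L]
      simp [max_eq_left (le_of_lt (mem_Ioi.1 hs))]
    · simp only [f, indicator_of_notMem hs, L]
      simp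
  have := hc.hasDerivAt_convolution_right L hf hq t
  rwa [key, key] at this

theorem W_Am1 [FiniteDimensional ℂ U] [CompleteSpace X] [CompleteSpace Xm1]
    (sys : SystemNode U X Xm1 Y)
    {q : ℝ → U} (hq : ContDiff ℝ 1 q) (hc : HasCompactSupport q) (t : ℝ) :
    sys.Am1 (sys.W q t) = sys.ι (sys.W (deriv q) t - sys.P 0 (q t)) := by
  have hq' : Continuous (deriv q) := hq.continuous_deriv le_rfl
  have i1 := sys.integrable_P (hq.continuous.comp (continuous_const.sub continuous_id))
    (comp_sub_compact hc t)
  have i2 := sys.integrable_P (hq'.comp (continuous_const.sub continuous_id))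
    (comp_sub_compact hc.deriv t)
  simp only [Function.comp_def, Pi.sub_apply, id] at i1 i2
  have hder : ∀ s, 0 ≤ s → HasDerivWithinAt (fun s => sys.ι (sys.P s (q (t - s))))
      (sys.Am1 (sys.P s (q (t - s))) - sys.ι (sys.P s (deriv q (t - s)))) (Ici 0) s := by
    intro s hs
    have hd : HasDerivAt (fun r => sys.R sys.betaPt (sys.B (q (t - r))))
        (sys.R sys.betaPt (sys.B (-deriv q (t - s)))) s := by
      have h1 : HasDerivAt (fun r => q (t - r)) (-deriv q (t - s)) s := by
        have := ((hq.differentiable one_ne_zero) (t - s)).hasDerivAt.scomp s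
          ((hasDerivAt_id s).const_sub t)
        simpa [Function.comp_def] using this
      exact (((sys.R sys.betaPt).comp sys.B).restrictScalars ℝ).hasFDerivAt.comp_hasDerivAt s h1
    have := sys.prodRule (D := Ici 0) (τ := fun r => r) (τ' := 1) hs (fun r hr => hr)
      (hasDerivWithinAt_id _ _) hd.hasDerivWithinAt
    simpa [P_apply, sub_eq_add_neg] using this
  have hI := integral_Ioi_of_hasDerivAt_of_tendsto (hder 0 le_rfl).continuousWithinAt
    (fun s hs => (hder s (le_of_lt hs)).hasDerivAt (Ici_mem_nhds hs))
    ((sys.Am1.integrable_comp i1).sub (sys.ι.integrable_comp i2)) (m := 0) (by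
      have := (comp_sub_compact hc t)
      rw [hasCompactSupport_iff_eventuallyEq] at this
      refine tendsto_const_nhds.congr' ?_
      have h2 := this.filter_mono (show Filter.atTop ≤ Filter.coclosedCompact ℝ by
        rw [Filter.coclosedCompact_eq_cocompact]; exact atTop_le_cocompact)
      filter_upwards [h2] with s hs
      simp [hs])
  rw [integral_sub (sys.Am1.integrable_comp i1) (sys.ι.integrable_comp i2),
    ContinuousLinearMap.integral_comp_comm _ i1, ContinuousLinearMap.integral_comp_comm _ i2] at hI
  rw [map_sub]
  simp only [sub_zero, zero_sub] at hI
  change sys.Am1 (sys.W q t) - sys.ι (sys.W (deriv q) t) = _ at hI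
  rw [sub_eq_iff_eq_add] at hI
  rw [hI]; abel

end SystemNode

open MeasureTheory Set
open scoped ENNReal NNReal Topology

/-- `β φ + φ'` -/
noncomputable def Lop {E : Type*} [NormedAddCommGroup E] [NormedSpace ℂ E] (β : ℂ) (φ : ℝ → E)
    (s : ℝ) : E := β • φ s + deriv φ s

theorem Lop_contDiff {E : Type*} [NormedAddCommGroup E] [NormedSpace ℂ E] (β : ℂ) {φ : ℝ → E}
    (h : ContDiff ℝ (⊤ : ℕ∞) φ) : ContDiff ℝ (⊤ : ℕ∞) (Lop β φ) := by
  unfold Lop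
  have : ContDiff ℝ (⊤ : ℕ∞) (deriv φ) := by
    have := (contDiff_infty_iff_deriv.1 h).2
    exact this
  exact (h.const_smul β).add this

theorem Lop_compact {E : Type*} [NormedAddCommGroup E] [NormedSpace ℂ E] (β : ℂ) {φ : ℝ → E}
    (h : HasCompactSupport φ) : HasCompactSupport (Lop β φ) := by
  unfold Lop
  exact (h.mono (fun s hs hx => hs (by simp [hx]))).add h.deriv

namespace SystemNode
variable {U X Xm1 Y : Type*}
  [NormedAddCommGroup U] [NormedSpace ℂ U]
  [NormedAddCommGroup X] [NormedSpace ℂ X]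
  [NormedAddCommGroup Xm1] [NormedSpace ℂ Xm1]
  [NormedAddCommGroup Y] [NormedSpace ℂ Y]

/-- impulse response functional -/
noncomputable def Phi (sys : SystemNode U X Xm1 Y) (φ : ℝ → U) : Y :=
  sys.G sys.betaPt (φ 0) + sys.K 0 (Lop sys.betaPt φ 0) +
    ∫ s in Ioi (0:ℝ), sys.K s (Lop sys.betaPt (Lop sys.betaPt φ) s)

theorem integrable_K [FiniteDimensional ℂ U] [CompleteSpace X] (sys : SystemNode U X Xm1 Y)
    {q : ℝ → U} (hq : Continuous q) (hc : HasCompactSupport q) :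
    IntegrableOn (fun s => sys.K s (q s)) (Ioi 0) :=
  sys.C1.integrable_comp (sys.integrable_P hq hc)

/-- the state of the explicit classical solution -/
noncomputable def xsol (sys : SystemNode U X Xm1 Y) (u : ℝ → U) (t : ℝ) : X :=
  sys.R sys.betaPt (sys.B (u t)) + sys.W (fun s => sys.betaPt • u s - deriv u s) t

theorem Lop_sub {E : Type*} [NormedAddCommGroup E] [NormedSpace ℂ E] (β : ℂ) (u : ℝ → E) (t s : ℝ) :
    Lop β (fun r => u (t - r)) s = β • u (t - s) - deriv u (t - s) := by
  unfold Lop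
  rw [deriv_comp_const_sub]
  simp [sub_eq_add_neg]

theorem exists_sol [FiniteDimensional ℂ U] [CompleteSpace X] [CompleteSpace Xm1] [CompleteSpace Y]
    (sys : SystemNode U X Xm1 Y) {u : ℝ → U} (hu : ContDiff ℝ (⊤ : ℕ∞) u)
    (hc : HasCompactSupport u) (hs : tsupport u ⊆ Ioi 0) :
    sys.IsClassicalSolution u (sys.xsol u) (fun t => sys.Phi (fun s => u (t - s))) ∧
      sys.xsol u 0 = 0 := by
  set q : ℝ → U := fun s => sys.betaPt • u s - deriv u s with hqdef
  have hu' : ContDiff ℝ (⊤ : ℕ∞) (deriv u) := (contDiff_infty_iff_deriv.1 hu).2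
  have hq : ContDiff ℝ (⊤ : ℕ∞) q := (hu.const_smul _).sub hu'
  have hqc : HasCompactSupport q :=
    (hc.mono (fun s hs hx => hs (by simp [hx]))).sub hc.deriv
  have hq1 : ContDiff ℝ 1 q := hq.of_le (by exact_mod_cast le_top)
  have hq' : ContDiff ℝ (⊤ : ℕ∞) (deriv q) := (contDiff_infty_iff_deriv.1 hq).2
  have hq1' : ContDiff ℝ 1 (deriv q) := hq'.of_le (by exact_mod_cast le_top)
  have hW : Continuous (sys.W q) := by
    rw [continuous_iff_continuousAt]
    exact fun t => (sys.W_hasDeriv hq1 hqc t).continuousAt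
  have hW' : Continuous (sys.W (deriv q)) := by
    rw [continuous_iff_continuousAt]
    exact fun t => (sys.W_hasDeriv hq1' hqc.deriv t).continuousAt
  have hx : ∀ t, HasDerivAt (sys.xsol u)
      (sys.R sys.betaPt (sys.B (deriv u t)) + sys.W (deriv q) t) t := by
    intro t
    have h1 : HasDerivAt (fun t => sys.R sys.betaPt (sys.B (u t)))
        (sys.R sys.betaPt (sys.B (deriv u t))) t :=
      (((sys.R sys.betaPt).comp sys.B).restrictScalars ℝ).hasFDerivAt.comp_hasDerivAt t
        (hu.differentiable (by simp) t).hasDerivAt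
    exact h1.add (sys.W_hasDeriv hq1 hqc t)
  have hA : ∀ t, sys.Am1 (sys.xsol u t) + sys.B (u t) =
      sys.ι (sys.R sys.betaPt (sys.B (deriv u t)) + sys.W (deriv q) t) := by
    intro t
    have h1 := sys.R_right sys.betaPt sys.hbeta (sys.B (u t))
    have h2 := sys.W_Am1 hq1 hqc t
    have h3 : sys.P 0 (q t) = sys.betaPt • sys.R sys.betaPt (sys.B (u t))
        - sys.R sys.betaPt (sys.B (deriv u t)) := by
      simp [P_apply, hqdef, sys.S.map_zero]
    rw [h3] at h2
    have : sys.xsol u t = sys.R sys.betaPt (sys.B (u t)) + sys.W q t := rfl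
    rw [this, map_add, h2]
    nth_rewrite 3 [← h1]
    simp only [map_add, map_sub, map_smul]
    abel
  have hy : ∀ t, sys.CD (sys.xsol u t) (u t) = sys.Phi (fun s => u (t - s)) := by
    intro t
    have h2 := sys.W_Am1 hq1 hqc t
    have : sys.xsol u t - sys.R sys.betaPt (sys.B (u t)) = sys.W q t := by
      simp [xsol, hqdef]
    rw [CD, this, sys.Cop_eq h2, Phi]
    have i1 := sys.integrable_P (hq.continuous.comp (continuous_const.sub continuous_id))
      (comp_sub_compact hqc t)
    have i2 := sys.integrable_P (hq'.continuous.comp (continuous_const.sub continuous_id))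
      (comp_sub_compact hqc.deriv t)
    simp only [Function.comp_def, Pi.sub_apply, id] at i1 i2
    have e1 : ∀ s, Lop sys.betaPt (fun s => u (t - s)) s = q (t - s) := fun s => Lop_sub _ _ _ _
    have e2 : ∀ s, Lop sys.betaPt (Lop sys.betaPt (fun s => u (t - s))) s =
        sys.betaPt • q (t - s) - deriv q (t - s) := by
      intro s
      rw [show Lop sys.betaPt (fun s => u (t - s)) = fun s => q (t - s) from funext e1]
      exact Lop_sub _ _ _ _
    have e3 : ∫ s in Ioi (0:ℝ), sys.K s (Lop sys.betaPt (Lop sys.betaPt (fun s => u (t - s))) s) =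
        sys.C1 (sys.betaPt • sys.W q t - sys.W (deriv q) t) := by
      have i3 : IntegrableOn (fun s => sys.betaPt • sys.P s (q (t - s))) (Ioi 0) := i1.smul _
      have i4 : IntegrableOn (fun s => sys.betaPt • sys.P s (q (t - s)) -
        sys.P s (deriv q (t - s))) (Ioi 0) := i3.sub i2
      rw [W, W, ← integral_smul, ← integral_sub i3 i2,
        ← ContinuousLinearMap.integral_comp_comm _ i4]
      congr 1
      ext s
      rw [e2]
      simp [K]
    rw [e3, e1]
    simp [K]
    abel
  refine ⟨⟨hu.continuous.continuousOn, ?_, ⟨_, ?_, fun t _ => (hx t).hasDerivWithinAt,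
    fun t _ => hA t⟩, fun t _ => (hy t).symm⟩, ?_⟩
  · have : (fun t => sys.Phi (fun s => u (t - s))) = fun t => sys.C1 (sys.betaPt • sys.W q t -
        (sys.W (deriv q) t - sys.P 0 (q t))) + sys.G sys.betaPt (u t) := by
      ext t
      rw [← hy, CD]
      have : sys.xsol u t - sys.R sys.betaPt (sys.B (u t)) = sys.W q t := by
        simp [xsol, hqdef]
      rw [this, sys.Cop_eq (sys.W_Am1 hq1 hqc t)]
    rw [this]
    have h1 := hu.continuous
    have h2 := hq.continuous
    apply Continuous.continuousOn
    fun_prop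
  · have h1 := hu'.continuous
    apply Continuous.continuousOn
    fun_prop
  · have h0 : ∀ t ≤ 0, u t = 0 := fun t ht => image_eq_zero_of_notMem_tsupport
      (fun h => absurd (hs h) (by simpa using ht))
    have h0' : ∀ t ≤ 0, deriv u t = 0 := fun t ht => image_eq_zero_of_notMem_tsupport
      (fun h => absurd (hs (tsupport_deriv_subset h)) (by simpa using ht))
    have : sys.W q 0 = 0 := by
      rw [W]
      apply setIntegral_eq_zero_of_forall_eq_zero
      intro s hs
      have : (0:ℝ) - s ≤ 0 := by simpa using le_of_lt hs
      simp only [hqdef, h0 _ this, h0' _ this]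
      simp
    change _ + sys.W q 0 = 0
    rw [this, h0 0 le_rfl]; simp

theorem output_eq [FiniteDimensional ℂ U] [CompleteSpace X] [CompleteSpace Xm1] [CompleteSpace Y]
    (sys : SystemNode U X Xm1 Y) {u : ℝ → U} (hu : ContDiff ℝ (⊤ : ℕ∞) u)
    (hc : HasCompactSupport u) (hs : tsupport u ⊆ Ioi 0) {x : ℝ → X} {y : ℝ → Y}
    (h : sys.IsClassicalSolution u x y) (h0 : x 0 = 0) {t : ℝ} (ht : 0 ≤ t) :
    y t = sys.Phi (fun s => u (t - s)) := by
  obtain ⟨⟨-, -, ⟨x1', -, hd1, hA1⟩, hy1⟩, hx1⟩ := sys.exists_sol hu hc hs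
  obtain ⟨-, -, ⟨x2', -, hd2, hA2⟩, hy2⟩ := h
  have := sys.unique_zero (d := fun t => x t - sys.xsol u t) (d' := fun t => x2' t - x1' t)
    (fun t ht => (hd2 t ht).sub (hd1 t ht)) (fun t ht => by
      rw [map_sub, map_sub, ← hA1 t ht, ← hA2 t ht]; abel) (by simp [h0, hx1]) t ht
  have e := hy1 t ht
  simp only at e
  rw [hy2 t ht, e, sub_eq_zero.1 this]

theorem R_laplace [CompleteSpace X] [CompleteSpace Xm1]
    (sys : SystemNode U X Xm1 Y) {σ : ℂ} (hσ : sys.S.growthBound < σ.re) (x : X) :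
    IntegrableOn (fun s : ℝ => Complex.exp (-(σ * s)) • sys.S.T s x) (Ioi 0) ∧
    ∫ s in Ioi (0:ℝ), Complex.exp (-(σ * s)) • sys.S.T s x = sys.R σ (sys.ι x) := by
  obtain ⟨M, hM0, w', hw', hM⟩ := sys.S.growth hσ
  have hcont : ContinuousOn (fun s : ℝ => Complex.exp (-(σ * s)) • sys.S.T s x) (Ici 0) :=
    ContinuousOn.smul (by fun_prop) (sys.S.strongly_continuous x)
  have hbd : ∀ s : ℝ, 0 ≤ s → ‖Complex.exp (-(σ * s)) • sys.S.T s x‖ ≤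
      M * ‖x‖ * Real.exp (-(σ.re - w') * s) := by
    intro s hs
    rw [norm_smul, Complex.norm_exp]
    calc _ ≤ Real.exp (-(σ * s)).re * (M * Real.exp (w' * s) * ‖x‖) := by
          gcongr; exact (sys.S.T s).le_of_opNorm_le (hM s hs) x
      _ = M * ‖x‖ * (Real.exp (-(σ * s)).re * Real.exp (w' * s)) := by ring
      _ = _ := by
        rw [← Real.exp_add]; congr 2; simp; ring
  have hint : IntegrableOn (fun s : ℝ => Complex.exp (-(σ * s)) • sys.S.T s x) (Ioi 0) := by
    refine Integrable.mono' ((exp_neg_integrableOn_Ioi 0 (show 0 < σ.re - w' by linarith)).const_mul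
      (M * ‖x‖)) ((hcont.mono Ioi_subset_Ici_self).aestronglyMeasurable measurableSet_Ioi) ?_
    exact (ae_restrict_mem measurableSet_Ioi).mono (fun s hs => hbd s (le_of_lt hs))
  refine ⟨hint, ?_⟩
  have hder : ∀ s : ℝ, 0 ≤ s → HasDerivWithinAt
      (fun s : ℝ => sys.ι (Complex.exp (-(σ * s)) • sys.S.T s x))
      (sys.Am1 (Complex.exp (-(σ * s)) • sys.S.T s x) -
        σ • sys.ι (Complex.exp (-(σ * s)) • sys.S.T s x)) (Ici 0) s := by
    intro s hs
    have hd : HasDerivAt (fun r : ℝ => Complex.exp (-(σ * r)) • x)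
        ((-σ * Complex.exp (-(σ * s))) • x) s := by
      have h1 : HasDerivAt (fun r : ℂ => Complex.exp (-(σ * r))) (-σ * Complex.exp (-(σ * s))) s := by
        have := (((hasDerivAt_id (s : ℂ)).const_mul σ).neg).cexp
        simpa [mul_comm] using this
      exact h1.comp_ofReal.smul_const x
    have := sys.prodRule (D := Ici 0) (τ := fun r => r) (τ' := 1) hs (fun r hr => hr)
      (hasDerivWithinAt_id _ _) hd.hasDerivWithinAt
    simpa [sub_eq_add_neg, mul_smul] using this
  have i1 := sys.Am1.integrable_comp hint
  have i2 : IntegrableOn (fun s : ℝ => σ • sys.ι (Complex.exp (-(σ * s)) • sys.S.T s x)) (Ioi 0) :=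
    (sys.ι.integrable_comp hint).smul σ
  have hI := integral_Ioi_of_hasDerivAt_of_tendsto (hder 0 le_rfl).continuousWithinAt
    (fun s hs => (hder s (le_of_lt hs)).hasDerivAt (Ici_mem_nhds hs))
    (i1.sub i2) (m := 0) (by
      have h1 : Filter.Tendsto (fun s : ℝ => Complex.exp (-(σ * s)) • sys.S.T s x)
          Filter.atTop (𝓝 0) := by
        apply squeeze_zero_norm' (a := fun s => M * ‖x‖ * Real.exp (-(σ.re - w') * s))
        · filter_upwards [Filter.eventually_ge_atTop 0] with s hs using hbd s hs
        · have h2 : Filter.Tendsto (fun s : ℝ => -(σ.re - w') * s) Filter.atTop Filter.atBot :=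
            Filter.tendsto_id.const_mul_atTop_of_neg (by linarith)
          simpa using (Real.tendsto_exp_atBot.comp h2).const_mul (M * ‖x‖)
      simpa [Function.comp_def] using (sys.ι.continuous.tendsto 0).comp h1)
  rw [integral_sub i1 i2, integral_smul,
    ContinuousLinearMap.integral_comp_comm _ hint, ContinuousLinearMap.integral_comp_comm _ hint] at hI
  simp [sys.S.map_zero] at hI
  have := sys.R_left σ hσ (∫ s in Ioi (0:ℝ), Complex.exp (-(σ * s)) • sys.S.T s x)
  rw [← this, ← neg_sub, hI, neg_neg]

theorem G_formula [CompleteSpace X] [CompleteSpace Xm1] [CompleteSpace Y]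
    (sys : SystemNode U X Xm1 Y) {σ : ℂ} (hσ : sys.S.growthBound < σ.re) (u : U) :
    IntegrableOn (fun s : ℝ => Complex.exp (-(σ * s)) • sys.K s u) (Ioi 0) ∧
    sys.G σ u = sys.G sys.betaPt u + (sys.betaPt - σ) • sys.K 0 u +
      (sys.betaPt - σ) ^ 2 • ∫ s in Ioi (0:ℝ), Complex.exp (-(σ * s)) • sys.K s u := by
  obtain ⟨h1, h2⟩ := sys.R_laplace hσ (sys.R sys.betaPt (sys.B u))
  have e : ∀ s : ℝ, sys.C1 (Complex.exp (-(σ * s)) • sys.S.T s (sys.R sys.betaPt (sys.B u))) =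
      Complex.exp (-(σ * s)) • sys.K s u := by
    intro s; rw [map_smul]; rfl
  have h3 := sys.C1.integrable_comp h1
  have h4 := sys.C1.integral_comp_comm h1
  simp only [e] at h3 h4
  refine ⟨h3, ?_⟩
  rw [h4, h2]
  have a1 := sys.R_right σ hσ (sys.B u)
  have a2 := sys.R_right sys.betaPt sys.hbeta (sys.B u)
  have a3 : sys.Am1 (sys.R σ (sys.B u) - sys.R sys.betaPt (sys.B u)) =
      sys.ι (σ • sys.R σ (sys.B u) - sys.betaPt • sys.R sys.betaPt (sys.B u)) := by
    have b1 := sub_eq_iff_eq_add.1 a1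
    have b2 := sub_eq_iff_eq_add.1 a2
    rw [map_sub, map_sub, map_smul, map_smul, b1, b2]; abel
  have a4 := sys.G_shift σ sys.betaPt hσ sys.hbeta u
  rw [sys.Cop_eq a3] at a4
  have a5 := sys.R_left σ hσ (sys.R sys.betaPt (sys.B u))
  have a6 : σ • sys.ι (sys.R sys.betaPt (sys.B u)) - sys.Am1 (sys.R sys.betaPt (sys.B u)) =
      sys.B u - (sys.betaPt - σ) • sys.ι (sys.R sys.betaPt (sys.B u)) := by
    nth_rewrite 3 [← a2]
    rw [sub_smul]; abel
  rw [a6, map_sub, map_smul, sub_eq_iff_eq_add] at a5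
  have a7 : sys.betaPt • (sys.R σ (sys.B u) - sys.R sys.betaPt (sys.B u)) -
      (σ • sys.R σ (sys.B u) - sys.betaPt • sys.R sys.betaPt (sys.B u)) =
      (sys.betaPt - σ) • sys.R σ (sys.B u) := by
    rw [smul_sub, sub_smul]; abel
  rw [a7, a5] at a4
  rw [sub_eq_iff_eq_add] at a4
  have a8 : sys.K 0 u = sys.C1 (sys.R sys.betaPt (sys.B u)) := by
    simp [K, P, sys.S.map_zero]
  rw [a4, a8]
  simp only [map_smul, map_add, smul_add, smul_smul, sq]
  abel

end SystemNode

open MeasureTheory Set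
open scoped ENNReal NNReal Topology

section Riesz
open BoundedContinuousFunction CompactlySupported

theorem exists_repr_hilbert {E H : Type*} [AddCommGroup E] [Module ℂ E] [NormedAddCommGroup H]
    [InnerProductSpace ℂ H] [CompleteSpace H] (j : E →ₗ[ℂ] H) (φ : E →ₗ[ℂ] ℂ) (C : ℝ)
    (h : ∀ x, ‖φ x‖ ≤ C * ‖j x‖) : ∃ v : H, ∀ x, φ x = inner ℂ v (j x) := by
  obtain ⟨s, hs⟩ := LinearMap.exists_rightInverse_of_surjective j.rangeRestrict
    (LinearMap.range_rangeRestrict j)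
  have hs' : ∀ r, j (s r) = r := fun r => by
    have := DFunLike.congr_fun hs r
    simpa using congrArg Subtype.val this
  have hφ : ∀ x, φ (s (j.rangeRestrict x)) = φ x := by
    intro x
    have := h (s (j.rangeRestrict x) - x)
    rw [map_sub, map_sub, hs'] at this
    simp at this
    exact sub_eq_zero.1 this
  let ψ : StrongDual ℂ (LinearMap.range j) := (φ.comp s).mkContinuous C (fun r => by
    have := h (s r)
    rwa [hs'] at this)
  obtain ⟨g, hg, -⟩ := exists_extension_norm_eq _ ψ
  refine ⟨(InnerProductSpace.toDual ℂ H).symm g, fun x => ?_⟩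
  rw [InnerProductSpace.toDual_symm_apply]
  have : g (j x) = ψ (j.rangeRestrict x) := hg (j.rangeRestrict x)
  rw [this, ← hφ]
  rfl

/-- set of admissible values -/
def rzSet (Φ : (ℝ →ᵇ ℂ) →L[ℂ] ℂ) (f : C_c(ℝ, ℝ≥0)) : Set ℝ≥0 :=
  {r | ∃ h : ℝ →ᵇ ℂ, (∀ x, ‖h x‖₊ ≤ f x) ∧ r = ‖Φ h‖₊}

theorem rzSet_le (Φ : (ℝ →ᵇ ℂ) →L[ℂ] ℂ) (f : C_c(ℝ, ℝ≥0)) {C : ℝ≥0} (hC : ∀ x, f x ≤ C) :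
    ∀ r ∈ rzSet Φ f, r ≤ ‖Φ‖₊ * C := by
  rintro r ⟨h, hh, rfl⟩
  refine (Φ.le_opNNNorm h).trans ?_
  gcongr
  rw [← NNReal.coe_le_coe, coe_nnnorm]
  exact (BoundedContinuousFunction.norm_le C.2).2 (fun x => by exact_mod_cast (hh x).trans (hC x))

theorem rzSet_nonempty (Φ : (ℝ →ᵇ ℂ) →L[ℂ] ℂ) (f : C_c(ℝ, ℝ≥0)) : (rzSet Φ f).Nonempty :=
  ⟨0, 0, by simp, by simp⟩

theorem rzSet_bdd (Φ : (ℝ →ᵇ ℂ) →L[ℂ] ℂ) (f : C_c(ℝ, ℝ≥0)) : BddAbove (rzSet Φ f) := by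
  obtain ⟨C, hC⟩ := (f.hasCompactSupport.isCompact_range f.continuous).bddAbove
  exact ⟨_, rzSet_le Φ f (C := C) (fun x => hC ⟨x, rfl⟩)⟩

theorem rz_split (f₁ f₂ : C_c(ℝ, ℝ≥0)) (h : ℝ →ᵇ ℂ) (hh : ∀ x, ‖h x‖₊ ≤ f₁ x + f₂ x) :
    ∃ h₁ h₂ : ℝ →ᵇ ℂ, h = h₁ + h₂ ∧ (∀ x, ‖h₁ x‖₊ ≤ f₁ x) ∧ (∀ x, ‖h₂ x‖₊ ≤ f₂ x) := by
  have key : ∀ f f' : C_c(ℝ, ℝ≥0), (∀ x, ‖h x‖₊ ≤ f x + f' x) →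
      ∃ g : ℝ →ᵇ ℂ, ∀ x, g x = (((f x / (f x + f' x) : ℝ≥0) : ℝ) : ℂ) * h x := by
    intro f f' hf
    have hle : ∀ x, ‖(((f x / (f x + f' x) : ℝ≥0) : ℝ) : ℂ) * h x‖ ≤ ‖h x‖ := by
      intro x
      rw [norm_mul, Complex.norm_real, NNReal.norm_eq]
      refine mul_le_of_le_one_left (norm_nonneg _) ?_
      exact_mod_cast div_le_one_of_le₀ (by simp) (by simp)
    refine ⟨BoundedContinuousFunction.ofNormedAddCommGroup
      (fun x => (((f x / (f x + f' x) : ℝ≥0) : ℝ) : ℂ) * h x) ?_ ‖h‖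
      (fun x => (hle x).trans (h.norm_coe_le_norm x)), fun x => rfl⟩
    rw [continuous_iff_continuousAt]
    intro x
    by_cases hx : f x + f' x = 0
    · have hx0 : h x = 0 := by simpa [hx] using hf x
      rw [ContinuousAt, hx0, mul_zero]
      apply squeeze_zero_norm hle
      have := h.continuous.norm.tendsto x
      simpa [hx0] using this
    · have c1 : ContinuousAt (fun x => f x / (f x + f' x)) x :=
        ContinuousAt.div f.continuous.continuousAt
          (f.continuous.add f'.continuous).continuousAt hx
      have c2 : Continuous (fun r : ℝ≥0 => ((r : ℝ) : ℂ)) := by fun_prop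
      exact (c2.continuousAt.comp c1).mul h.continuous.continuousAt
  have bd : ∀ (f f' : C_c(ℝ, ℝ≥0)), (∀ x, ‖h x‖₊ ≤ f x + f' x) → ∀ x,
      ‖(((f x / (f x + f' x) : ℝ≥0) : ℝ) : ℂ) * h x‖₊ ≤ f x := by
    intro f f' hf x
    rw [nnnorm_mul]
    have e : ‖(((f x / (f x + f' x) : ℝ≥0) : ℝ) : ℂ)‖₊ = f x / (f x + f' x) := by
      ext; rw [coe_nnnorm, Complex.norm_real, NNReal.norm_eq]
    rw [e]
    calc _ ≤ f x / (f x + f' x) * (f x + f' x) := by gcongr; exact hf x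
      _ ≤ f x := by
        by_cases h0 : f x + f' x = 0
        · simp [h0]
        · rw [div_mul_cancel₀ _ h0]
  obtain ⟨h₁, e₁⟩ := key f₁ f₂ hh
  have hh' : ∀ x, ‖h x‖₊ ≤ f₂ x + f₁ x := fun x => by rw [add_comm]; exact hh x
  obtain ⟨h₂, e₂⟩ := key f₂ f₁ hh'
  refine ⟨h₁, h₂, ?_, fun x => ?_, fun x => ?_⟩
  · ext x
    rw [BoundedContinuousFunction.add_apply, e₁, e₂, ← add_mul]
    by_cases hx : f₁ x + f₂ x = 0
    · have hx0 : h x = 0 := by simpa [hx] using hh x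
      simp [hx0]
    · rw [add_comm (f₂ x), ← Complex.ofReal_add, ← NNReal.coe_add, ← add_div, div_self hx]
      simp
  · rw [e₁]; exact bd f₁ f₂ hh x
  · rw [e₂]; exact bd f₂ f₁ hh' x

theorem rz_phase (Φ : (ℝ →ᵇ ℂ) →L[ℂ] ℂ) (h : ℝ →ᵇ ℂ) :
    ∃ h' : ℝ →ᵇ ℂ, (∀ x, ‖h' x‖₊ = ‖h x‖₊) ∧ Φ h' = ((‖Φ h‖ : ℝ) : ℂ) := by
  by_cases hz : Φ h = 0
  · exact ⟨h, fun x => rfl, by simp [hz]⟩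
  · have hz' : (‖Φ h‖ : ℂ) ≠ 0 := by simpa using hz
    refine ⟨((starRingEnd ℂ (Φ h)) / (‖Φ h‖ : ℂ)) • h, fun x => ?_, ?_⟩
    · ext
      simp
      rw [div_self (by simpa using hz)]; simp
    · rw [map_smul, smul_eq_mul, div_mul_eq_mul_div, mul_comm, Complex.mul_conj,
        Complex.normSq_eq_norm_sq]
      push_cast
      field_simp

theorem nn_sSup_add {S₁ S₂ : Set ℝ≥0} (h₁ : S₁.Nonempty) (h₂ : S₂.Nonempty) {c : ℝ≥0}
    (h : ∀ a ∈ S₁, ∀ b ∈ S₂, a + b ≤ c) : sSup S₁ + sSup S₂ ≤ c := by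
  have s1 : ∀ b ∈ S₂, sSup S₁ + b ≤ c := by
    intro b hb
    obtain ⟨a, ha⟩ := h₁
    have hbc : b ≤ c := le_trans (by simp) (h a ha b hb)
    apply add_le_of_le_tsub_right_of_le hbc
    exact csSup_le ⟨a, ha⟩ (fun a ha => le_tsub_of_add_le_right (h a ha b hb))
  obtain ⟨b, hb⟩ := h₂
  have hbc : sSup S₁ ≤ c := le_trans (by simp) (s1 b hb)
  apply add_le_of_le_tsub_left_of_le hbc
  exact csSup_le ⟨b, hb⟩ (fun b hb => le_tsub_of_add_le_left (s1 b hb))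

theorem nn_mul_sSup {S : Set ℝ≥0} (hS : S.Nonempty) {c d : ℝ≥0}
    (h : ∀ a ∈ S, c * a ≤ d) : c * sSup S ≤ d := by
  by_cases hc : c = 0
  · simp [hc]
  · have hc' : 0 < c := pos_iff_ne_zero.2 hc
    rw [← le_div_iff₀' hc']
    exact csSup_le hS (fun a ha => (le_div_iff₀' hc').2 (h a ha))

/-- total variation functional -/
noncomputable def rzLin (Φ : (ℝ →ᵇ ℂ) →L[ℂ] ℂ) : C_c(ℝ, ℝ≥0) →ₗ[ℝ≥0] ℝ≥0 where
  toFun f := sSup (rzSet Φ f)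
  map_add' f₁ f₂ := by
    apply le_antisymm
    · apply csSup_le (rzSet_nonempty _ _)
      rintro r ⟨h, hh, rfl⟩
      obtain ⟨h₁, h₂, rfl, b₁, b₂⟩ := rz_split f₁ f₂ h hh
      rw [map_add]
      refine (nnnorm_add_le _ _).trans (add_le_add ?_ ?_)
      · exact le_csSup (rzSet_bdd _ _) ⟨h₁, b₁, rfl⟩
      · exact le_csSup (rzSet_bdd _ _) ⟨h₂, b₂, rfl⟩
    · apply nn_sSup_add (rzSet_nonempty _ _) (rzSet_nonempty _ _)
      rintro _ ⟨h₁, b₁, rfl⟩ _ ⟨h₂, b₂, rfl⟩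
      obtain ⟨h₁', c₁, d₁⟩ := rz_phase Φ h₁
      obtain ⟨h₂', c₂, d₂⟩ := rz_phase Φ h₂
      apply le_csSup (rzSet_bdd _ _)
      refine ⟨h₁' + h₂', fun x => ?_, ?_⟩
      · refine (nnnorm_add_le _ _).trans ?_
        rw [c₁, c₂]
        exact add_le_add (b₁ x) (b₂ x)
      · rw [map_add, d₁, d₂, ← Complex.ofReal_add]
        ext
        simp only [coe_nnnorm, NNReal.coe_add, Complex.norm_real, Real.norm_eq_abs]
        rw [abs_of_nonneg (by positivity)]
  map_smul' c f := by
    have h1 : ∀ (c : ℝ≥0) (f : C_c(ℝ, ℝ≥0)), c * sSup (rzSet Φ f) ≤ sSup (rzSet Φ (c • f)) := by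
      intro c f
      apply nn_mul_sSup (rzSet_nonempty _ _)
      rintro _ ⟨h, hh, rfl⟩
      apply le_csSup (rzSet_bdd _ _)
      refine ⟨((c : ℝ) : ℂ) • h, fun x => ?_, ?_⟩
      · simp only [BoundedContinuousFunction.smul_apply, nnnorm_smul]
        have : ‖((c : ℝ) : ℂ)‖₊ = c := by ext; simp
        rw [this]
        exact mul_le_mul_right (hh x) c
      · rw [map_smul, nnnorm_smul]
        have : ‖((c : ℝ) : ℂ)‖₊ = c := by ext; simp
        rw [this]
    apply le_antisymm
    · by_cases hc : c = 0
      · subst hc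
        apply csSup_le (rzSet_nonempty _ _)
        intro r hr
        simpa using rzSet_le Φ ((0:ℝ≥0) • f) (C := 0) (fun x => by simp) r hr
      · have := h1 c⁻¹ (c • f)
        rw [smul_smul, inv_mul_cancel₀ hc, one_smul] at this
        simpa [smul_eq_mul, RingHom.id_apply] using (inv_mul_le_iff₀ (pos_iff_ne_zero.2 hc)).1 this
    · exact h1 c f

theorem rz_le (Φ : (ℝ →ᵇ ℂ) →L[ℂ] ℂ) (h : ℝ →ᵇ ℂ) (hc : HasCompactSupport h) :
    ‖Φ h‖ ≤ ∫ x, ‖h x‖ ∂(NNRealRMK.rieszMeasure (rzLin Φ)) := by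
  let f : C_c(ℝ, ℝ≥0) := ⟨⟨fun x => ‖h x‖₊, by fun_prop⟩, hc.comp_left (g := fun z => ‖z‖₊) (by simp)⟩
  have := NNRealRMK.integral_rieszMeasure (rzLin Φ) f
  have e : ∫ x, ‖h x‖ ∂(NNRealRMK.rieszMeasure (rzLin Φ)) = rzLin Φ f := this
  rw [e]
  have : ‖Φ h‖₊ ≤ rzLin Φ f := le_csSup (rzSet_bdd _ _) ⟨h, fun x => le_rfl, rfl⟩
  exact_mod_cast this

theorem rz_finite (Φ : (ℝ →ᵇ ℂ) →L[ℂ] ℂ) : IsFiniteMeasure (NNRealRMK.rieszMeasure (rzLin Φ)) := by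
  refine ⟨?_⟩
  have key : ∀ n : ℕ, NNRealRMK.rieszMeasure (rzLin Φ) (Icc (-n:ℝ) n) ≤ (‖Φ‖₊ : ℝ≥0∞) := by
    intro n
    let f : C_c(ℝ, ℝ≥0) := ⟨⟨fun x => Real.toNNReal (min 1 (n + 1 - |x|)), by fun_prop⟩, by
      apply HasCompactSupport.of_support_subset_isCompact (isCompact_Icc (a := -(n+1:ℝ)) (b := n + 1))
      intro x hx
      rw [mem_Icc, ← abs_le]
      by_contra hlt
      push Not at hlt
      apply hx
      simp only
      rw [Real.toNNReal_eq_zero]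
      exact (min_le_right _ _).trans (by linarith)⟩
    have hf : ∀ x, f x = Real.toNNReal (min 1 (n + 1 - |x|)) := fun x => rfl
    have h1 : rzLin Φ f ≤ ‖Φ‖₊ := by
      apply csSup_le (rzSet_nonempty _ _)
      intro r hr
      simpa using rzSet_le Φ f (C := 1) (fun x => by rw [hf]; simp) r hr
    calc NNRealRMK.rieszMeasure (rzLin Φ) (Icc (-n:ℝ) n)
        = ∫⁻ x in Icc (-n:ℝ) n, 1 ∂(NNRealRMK.rieszMeasure (rzLin Φ)) := by simp
      _ ≤ ∫⁻ x in Icc (-n:ℝ) n, f x ∂(NNRealRMK.rieszMeasure (rzLin Φ)) := by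
          apply setLIntegral_mono' measurableSet_Icc
          intro x hx
          have hx' : |x| ≤ n := abs_le.2 hx
          rw [hf, min_eq_left (by linarith)]
          simp
      _ ≤ ∫⁻ x, f x ∂(NNRealRMK.rieszMeasure (rzLin Φ)) := setLIntegral_le_lintegral _ _
      _ = rzLin Φ f := NNRealRMK.lintegral_rieszMeasure _ _
      _ ≤ _ := by exact_mod_cast h1
  have hU : (⋃ n : ℕ, Icc (-n:ℝ) n) = univ := by
    rw [eq_univ_iff_forall]
    intro x
    obtain ⟨n, hn⟩ := exists_nat_ge |x|
    exact mem_iUnion.2 ⟨n, abs_le.1 hn⟩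
  have hm : Monotone (fun n : ℕ => Icc (-n:ℝ) n) := fun m n hmn =>
    Icc_subset_Icc (by simpa using hmn) (by simpa using hmn)
  rw [← hU, hm.measure_iUnion]
  exact lt_of_le_of_lt (iSup_le key) ENNReal.coe_lt_top

theorem riesz_scalar (Φ : (ℝ →ᵇ ℂ) →L[ℂ] ℂ) :
    ∃ (μ : Measure ℝ) (g : ℝ → ℂ), IsFiniteMeasure μ ∧ Integrable g μ ∧
      ∀ h : ℝ →ᵇ ℂ, HasCompactSupport h → Φ h = ∫ x, h x * g x ∂μ := by
  set μ := NNRealRMK.rieszMeasure (rzLin Φ) with hμ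
  haveI : IsFiniteMeasure μ := rz_finite Φ
  let E : Submodule ℂ (ℝ →ᵇ ℂ) :=
    { carrier := {h | HasCompactSupport h}
      add_mem' := fun {a b} ha hb => HasCompactSupport.add (f := a) (f' := b) ha hb
      zero_mem' := HasCompactSupport.zero
      smul_mem' := fun c h hh => HasCompactSupport.mono (f := h) hh
        (fun s hs hx => hs (by simp [hx])) }
  let T := BoundedContinuousFunction.toLp (α := ℝ) (E := ℂ) 2 μ ℂ
  obtain ⟨v, hv⟩ := exists_repr_hilbert (T.toLinearMap.comp E.subtype)
    (Φ.toLinearMap.comp E.subtype) ((μ univ ^ (1/2:ℝ)).toReal) (fun x => by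
      refine (rz_le Φ x.1 x.2).trans ?_
      have hx : AEStronglyMeasurable (x.1 : ℝ → ℂ) μ := x.1.continuous.aestronglyMeasurable
      have h1 := eLpNorm_le_eLpNorm_mul_rpow_measure_univ (p := 1) (q := 2) (by norm_num) hx
      have h2 : ‖T x.1‖ = (eLpNorm (x.1 : ℝ → ℂ) 2 μ).toReal := by
        rw [Lp.norm_def]
        congr 1
        exact eLpNorm_congr_ae (BoundedContinuousFunction.coeFn_toLp 2 μ ℂ x.1)
      have h3 : ∫ t, ‖x.1 t‖ ∂μ = (eLpNorm (x.1 : ℝ → ℂ) 1 μ).toReal := by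
        rw [eLpNorm_one_eq_lintegral_enorm, integral_norm_eq_lintegral_enorm hx]
      change ∫ t, ‖x.1 t‖ ∂μ ≤ _ * ‖T x.1‖
      rw [h2, h3, ← ENNReal.toReal_mul]
      have h4 : eLpNorm (x.1 : ℝ → ℂ) 2 μ < ⊤ := (MemLp.of_bound hx ‖x.1‖
        (Filter.Eventually.of_forall (fun t => x.1.norm_coe_le_norm t))).2
      apply ENNReal.toReal_mono
      · exact ENNReal.mul_ne_top (ENNReal.rpow_ne_top_of_nonneg (by norm_num) (measure_ne_top _ _)) h4.ne
      · rw [mul_comm]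
        refine h1.trans (le_of_eq ?_)
        congr 2
        norm_num)
  refine ⟨μ, fun x => starRingEnd ℂ (v x), inferInstance, ?_, fun h hh => ?_⟩
  · have := (Lp.memLp v).integrable (by norm_num)
    exact (Complex.conjCLE : ℂ →L[ℝ] ℂ).integrable_comp this
  · have := hv ⟨h, hh⟩
    change Φ h = inner ℂ v (T h) at this
    rw [this, L2.inner_def]
    apply integral_congr_ae
    filter_upwards [BoundedContinuousFunction.coeFn_toLp 2 μ ℂ h] with x hx
    rw [hx]
    simp [RCLike.inner_apply]

end Riesz

open MeasureTheory Set
open scoped ENNReal NNReal Topology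

theorem Lop_exp {E : Type*} [NormedAddCommGroup E] [NormedSpace ℂ E] (β σ : ℂ) {a : ℝ → E}
    (ha : Differentiable ℝ a) :
    Lop β (fun s : ℝ => Complex.exp (-(σ * s)) • a s) =
      fun s : ℝ => Complex.exp (-(σ * s)) • Lop (β - σ) a s := by
  funext s
  have h1 : HasDerivAt (fun s : ℝ => Complex.exp (-(σ * s))) (Complex.exp (-(σ * s)) * (-σ)) s := by
    have : HasDerivAt (fun z : ℂ => Complex.exp (-(σ * z))) (Complex.exp (-(σ * s)) * (-σ)) (s : ℂ) := by
      have := ((hasDerivAt_id (s : ℂ)).const_mul σ).neg.cexp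
      simpa using this
    exact this.comp_ofReal
  have h2 := h1.smul (ha s).hasDerivAt
  unfold Lop
  rw [show deriv (fun s : ℝ => Complex.exp (-(σ * s)) • a s) s = _ from h2.deriv]
  module

theorem cexp_contDiff (σ : ℂ) : ContDiff ℝ (⊤ : ℕ∞) (fun s : ℝ => Complex.exp (-(σ * s))) :=
  ((contDiff_const.mul Complex.ofRealCLM.contDiff).neg).cexp

theorem Lop_congr {E : Type*} [NormedAddCommGroup E] [NormedSpace ℂ E] (β : ℂ) {a b : ℝ → E} {s : ℝ}
    (h : a =ᶠ[𝓝 s] b) : Lop β a =ᶠ[𝓝 s] Lop β b := by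
  filter_upwards [h, h.deriv] with t h1 h2
  unfold Lop
  rw [h1, h2]

theorem Lop_add {E : Type*} [NormedAddCommGroup E] [NormedSpace ℂ E] (β : ℂ) {a b : ℝ → E}
    (ha : ContDiff ℝ (⊤ : ℕ∞) a) (hb : ContDiff ℝ (⊤ : ℕ∞) b) :
    Lop β (fun s => a s + b s) = fun s => Lop β a s + Lop β b s := by
  funext s
  unfold Lop
  have h1 := (ha.differentiable (by simp)) s
  have h2 := (hb.differentiable (by simp)) s
  rw [show deriv (fun s => a s + b s) s = _ from (h1.hasDerivAt.add h2.hasDerivAt).deriv]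
  module

theorem Lop_smul {E : Type*} [NormedAddCommGroup E] [NormedSpace ℂ E] (β c : ℂ) {a : ℝ → E}
    (ha : ContDiff ℝ (⊤ : ℕ∞) a) :
    Lop β (fun s => c • a s) = fun s => c • Lop β a s := by
  funext s
  unfold Lop
  have h1 := (ha.differentiable (by simp)) s
  rw [show deriv (fun s => c • a s) s = _ from (h1.hasDerivAt.const_smul c).deriv]
  module

/-- bump -/
noncomputable def bmp : ContDiffBump (0 : ℝ) := ⟨1, 2, by norm_num, by norm_num⟩

/-- cutoff -/
noncomputable def cut (n : ℕ) (s : ℝ) : ℝ :=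
  bmp ((n + 1 : ℝ)⁻¹ * s) * Real.smoothTransition ((n + 1 : ℝ) * s + 2)

theorem cut_contDiff (n : ℕ) : ContDiff ℝ (⊤ : ℕ∞) (cut n) := by
  unfold cut
  exact (bmp.contDiff.comp (by fun_prop)).mul (Real.smoothTransition.contDiff.comp (by fun_prop))

theorem cut_nonneg (n : ℕ) (s : ℝ) : 0 ≤ cut n s :=
  mul_nonneg bmp.nonneg (Real.smoothTransition.nonneg _)

theorem cut_le_one (n : ℕ) (s : ℝ) : cut n s ≤ 1 :=
  mul_le_one₀ bmp.le_one (Real.smoothTransition.nonneg _) (Real.smoothTransition.le_one _)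

theorem cut_compact (n : ℕ) : HasCompactSupport (cut n) := by
  apply HasCompactSupport.of_support_subset_isCompact
    (isCompact_Icc (a := -(2 * (n+1) : ℝ)) (b := 2 * (n + 1)))
  intro s hs
  rw [mem_Icc, ← abs_le]
  by_contra hlt
  push Not at hlt
  apply hs
  unfold cut
  rw [bmp.zero_of_le_dist, zero_mul]
  rw [Real.dist_eq, sub_zero, abs_mul, abs_of_pos (by positivity)]
  change 2 ≤ _
  rw [le_inv_mul_iff₀ (by positivity)]
  linarith

theorem cut_eq (n : ℕ) {s : ℝ} (hs : 0 ≤ s) : cut n =ᶠ[𝓝 s] fun s => bmp ((n + 1 : ℝ)⁻¹ * s) := by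
  have : ∀ᶠ t in 𝓝 s, -(1 / (n+1:ℝ)) < t := by
    apply Ioi_mem_nhds
    have : 0 < 1 / (n + 1:ℝ) := by positivity
    linarith
  filter_upwards [this] with t ht
  unfold cut
  rw [Real.smoothTransition.one_of_one_le, mul_one]
  have h : (0:ℝ) < n + 1 := by positivity
  have : (n + 1:ℝ) * (-(1 / (n+1:ℝ))) < (n + 1) * t := mul_lt_mul_of_pos_left ht h
  have e : (n + 1:ℝ) * (-(1 / (n+1:ℝ))) = -1 := by field_simp
  linarith

theorem cut_zero (n : ℕ) {s : ℝ} (hs : s ≤ -2) : cut n s = 0 := by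
  unfold cut
  rw [Real.smoothTransition.zero_of_nonpos, mul_zero]
  have : (1:ℝ) ≤ n + 1 := by simp
  nlinarith

theorem cut_tendsto_neg {s : ℝ} (hs : s < 0) : ∀ᶠ n in Filter.atTop, cut n s = 0 := by
  obtain ⟨N, hN⟩ := exists_nat_ge (2 / (-s))
  filter_upwards [Filter.eventually_ge_atTop N] with n hn
  unfold cut
  rw [Real.smoothTransition.zero_of_nonpos, mul_zero]
  rw [div_le_iff₀ (by linarith)] at hN
  have : (N : ℝ) ≤ n := by exact_mod_cast hn
  nlinarith

theorem bmp_one {s : ℝ} (hs : 0 ≤ s) : ∀ᶠ n : ℕ in Filter.atTop,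
    (fun s => bmp ((n + 1 : ℝ)⁻¹ * s)) =ᶠ[𝓝 s] fun _ => 1 := by
  obtain ⟨N, hN⟩ := exists_nat_ge s
  filter_upwards [Filter.eventually_ge_atTop N] with n hn
  have hn' : (N : ℝ) ≤ n := by exact_mod_cast hn
  have : ∀ᶠ t in 𝓝 s, t ∈ Ioo (-1:ℝ) (n + 1) := Ioo_mem_nhds (by linarith) (by linarith)
  filter_upwards [this] with t ht
  apply bmp.one_of_mem_closedBall
  rw [mem_closedBall_zero_iff, Real.norm_eq_abs, abs_mul, abs_of_pos (by positivity)]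
  change _ ≤ (1:ℝ)
  rw [inv_mul_le_iff₀ (by positivity), mul_one, abs_le]
  have : (0:ℝ) ≤ n := by positivity
  constructor <;> linarith [ht.1, ht.2]

theorem cut_one {s : ℝ} (hs : 0 ≤ s) : ∀ᶠ n : ℕ in Filter.atTop, cut n =ᶠ[𝓝 s] fun _ => 1 := by
  filter_upwards [bmp_one hs] with n hn
  exact (cut_eq n hs).trans hn

theorem cut_bound (E : Type*) [NormedAddCommGroup E] [NormedSpace ℂ E] (γ : ℂ) (u : E) : ∃ D : ℝ,
    ∀ n : ℕ, ∀ s : ℝ, 0 ≤ s → ‖Lop γ (Lop γ (fun s => (cut n s : ℂ) • u)) s‖ ≤ D := by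
  have hb0 : ContDiff ℝ (⊤ : ℕ∞) (bmp : ℝ → ℝ) := bmp.contDiff
  have hb1 : ContDiff ℝ (⊤ : ℕ∞) (deriv bmp) := (contDiff_infty_iff_deriv.1 hb0).2
  have hb2 : ContDiff ℝ (⊤ : ℕ∞) (deriv (deriv bmp)) := (contDiff_infty_iff_deriv.1 hb1).2
  have hc0 : HasCompactSupport (bmp : ℝ → ℝ) := bmp.hasCompactSupport
  obtain ⟨C0, hC0⟩ := hc0.exists_bound_of_continuous hb0.continuous
  obtain ⟨C1, hC1⟩ := hc0.deriv.exists_bound_of_continuous hb1.continuous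
  obtain ⟨C2, hC2⟩ := hc0.deriv.deriv.exists_bound_of_continuous hb2.continuous
  refine ⟨‖γ‖ * (‖γ‖ * (C0 * ‖u‖) + C1 * ‖u‖) + (‖γ‖ * (C1 * ‖u‖) + C2 * ‖u‖), fun n s hs => ?_⟩
  set r : ℝ := (n + 1 : ℝ)⁻¹ with hr
  have hr0 : 0 ≤ r := by positivity
  have hr1 : r ≤ 1 := inv_le_one_of_one_le₀ (by simp)
  have e1 : (fun s => (cut n s : ℂ) • u) =ᶠ[𝓝 s] fun s => (bmp (r * s) : ℂ) • u := by
    filter_upwards [cut_eq n hs] with t ht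
    rw [ht]
  rw [((Lop_congr γ (Lop_congr γ e1))).eq_of_nhds]
  have d : ∀ f : ℝ → ℝ, ContDiff ℝ (⊤ : ℕ∞) f → ∀ t,
      HasDerivAt (fun s => (f (r * s) : ℂ) • u) ((r * deriv f (r * t) : ℂ) • u) t := by
    intro f hf t
    have h1 : HasDerivAt f (deriv f (r * t)) (r * t) :=
      ((hf.differentiable (by simp)) _).hasDerivAt
    have h2 : HasDerivAt (fun s => f (r * s)) (deriv f (r * t) * r) t := by
      have := h1.comp t ((hasDerivAt_id t).const_mul r)
      simpa [Function.comp_def] using this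
    have h3 := h2.ofReal_comp.smul_const u
    convert h3 using 2
    push_cast; ring
  have L1 : Lop γ (fun s => (bmp (r * s) : ℂ) • u) =
      fun s => γ • ((bmp (r * s) : ℂ) • u) + (r : ℂ) • (((deriv bmp (r * s) : ℝ) : ℂ) • u) := by
    funext t
    unfold Lop
    rw [(d _ hb0 t).deriv, smul_smul (r : ℂ)]
  rw [L1]
  unfold Lop
  have D2 : HasDerivAt (fun s => γ • ((bmp (r * s) : ℂ) • u) + (r : ℂ) • (((deriv bmp (r * s) : ℝ) : ℂ) • u))
      (γ • ((r * (deriv bmp (r * s) : ℝ) : ℂ) • u) + (r : ℂ) • ((r * (deriv (deriv bmp) (r * s) : ℝ) : ℂ) • u)) s :=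
    ((d _ hb0 s).const_smul γ).add ((d _ hb1 s).const_smul (r : ℂ))
  rw [D2.deriv]
  have c0 := hC0 (r * s)
  have c1 := hC1 (r * s)
  have c2 := hC2 (r * s)
  have nr : ‖(r : ℂ)‖ ≤ 1 := by rwa [Complex.norm_real, Real.norm_of_nonneg hr0]
  have C1p : 0 ≤ C1 := (norm_nonneg _).trans c1
  have C2p : 0 ≤ C2 := (norm_nonneg _).trans c2
  refine (norm_add_le _ _).trans (add_le_add ?_ ?_)
  · rw [norm_smul]
    refine mul_le_mul_of_nonneg_left ((norm_add_le _ _).trans (add_le_add ?_ ?_)) (norm_nonneg _)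
    · rw [norm_smul, norm_smul, Complex.norm_real]; gcongr
    · rw [norm_smul, norm_smul, Complex.norm_real (deriv bmp (r * s))]
      calc _ ≤ 1 * (C1 * ‖u‖) := by gcongr
        _ = _ := one_mul _
  · refine (norm_add_le _ _).trans (add_le_add ?_ ?_)
    · rw [norm_smul, norm_smul, norm_mul, Complex.norm_real (deriv bmp _)]
      gcongr
      calc _ ≤ 1 * C1 := by gcongr
        _ = _ := one_mul _
    · rw [norm_smul, norm_smul, norm_mul, Complex.norm_real (deriv (deriv bmp) _)]
      calc _ ≤ 1 * ((1 * C2) * ‖u‖) := by gcongr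
        _ = _ := by ring

namespace SystemNode
variable {U X Xm1 Y : Type*}
  [NormedAddCommGroup U] [NormedSpace ℂ U]
  [NormedAddCommGroup X] [NormedSpace ℂ X]
  [NormedAddCommGroup Xm1] [NormedSpace ℂ Xm1]
  [NormedAddCommGroup Y] [NormedSpace ℂ Y]

theorem Phi_add [FiniteDimensional ℂ U] [CompleteSpace X] (sys : SystemNode U X Xm1 Y)
    {a b : ℝ → U} (ha : ContDiff ℝ (⊤ : ℕ∞) a) (hb : ContDiff ℝ (⊤ : ℕ∞) b)
    (hac : HasCompactSupport a) (hbc : HasCompactSupport b) :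
    sys.Phi (fun s => a s + b s) = sys.Phi a + sys.Phi b := by
  unfold Phi
  rw [Lop_add _ ha hb, Lop_add _ (Lop_contDiff _ ha) (Lop_contDiff _ hb)]
  simp only [map_add]
  rw [integral_add]
  · abel
  · exact sys.integrable_K (Lop_contDiff _ (Lop_contDiff _ ha)).continuous
      (Lop_compact _ (Lop_compact _ hac))
  · exact sys.integrable_K (Lop_contDiff _ (Lop_contDiff _ hb)).continuous
      (Lop_compact _ (Lop_compact _ hbc))

theorem Phi_smul (sys : SystemNode U X Xm1 Y) (c : ℂ)
    {a : ℝ → U} (ha : ContDiff ℝ (⊤ : ℕ∞) a) :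
    sys.Phi (fun s => c • a s) = c • sys.Phi a := by
  unfold Phi
  rw [Lop_smul _ _ ha, Lop_smul _ _ (Lop_contDiff _ ha)]
  simp only [map_smul]
  rw [integral_smul]
  simp only [smul_add]

theorem Phi_tendsto [FiniteDimensional ℂ U] [CompleteSpace X] [CompleteSpace Xm1] [CompleteSpace Y]
    (sys : SystemNode U X Xm1 Y)
    {σ : ℂ} (hσ : sys.S.growthBound < σ.re) (u : U) :
    Filter.Tendsto (fun n : ℕ => sys.Phi (fun s : ℝ => Complex.exp (-(σ * s)) • ((cut n s : ℂ) • u)))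
      Filter.atTop (𝓝 (sys.G σ u)) := by
  obtain ⟨-, hG⟩ := sys.G_formula hσ u
  rw [hG]
  set β := sys.betaPt
  have hcd : ∀ n, ContDiff ℝ (⊤ : ℕ∞) (fun s => (cut n s : ℂ) • u) := fun n =>
    (Complex.ofRealCLM.contDiff.comp (cut_contDiff n)).smul contDiff_const
  have hcc : ∀ n, HasCompactSupport (fun s => (cut n s : ℂ) • u) := fun n =>
    (cut_compact n).mono (fun s hs hx => hs (by simp [hx]))
  have L1 : ∀ n, Lop β (fun s : ℝ => Complex.exp (-(σ * s)) • ((cut n s : ℂ) • u)) =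
      fun s : ℝ => Complex.exp (-(σ * s)) • Lop (β - σ) (fun s => (cut n s : ℂ) • u) s := fun n =>
    Lop_exp _ _ ((hcd n).differentiable (by simp))
  have L2 : ∀ n, Lop β (Lop β (fun s : ℝ => Complex.exp (-(σ * s)) • ((cut n s : ℂ) • u))) =
      fun s : ℝ => Complex.exp (-(σ * s)) • Lop (β - σ) (Lop (β - σ) (fun s => (cut n s : ℂ) • u)) s := fun n => by
    rw [L1]
    exact Lop_exp _ _ ((Lop_contDiff _ (hcd n)).differentiable (by simp))
  have cst : ∀ γ : ℂ, ∀ v : U, Lop γ (fun _ : ℝ => v) = fun _ => γ • v := by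
    intro γ v; funext s; simp [Lop]
  have ev : ∀ s : ℝ, 0 ≤ s → ∀ᶠ n : ℕ in Filter.atTop,
      (fun s => (cut n s : ℂ) • u) =ᶠ[𝓝 s] fun _ => u := by
    intro s hs
    filter_upwards [cut_one hs] with n hn
    filter_upwards [hn] with t ht
    rw [ht]; simp
  unfold Phi
  refine Filter.Tendsto.add (Filter.Tendsto.add ?_ ?_) ?_
  · apply tendsto_const_nhds.congr'
    filter_upwards [ev 0 le_rfl] with n hn
    have : (cut n 0 : ℂ) • u = u := hn.eq_of_nhds
    rw [this]; simp [β]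
  · apply tendsto_const_nhds.congr'
    filter_upwards [ev 0 le_rfl] with n hn
    have := (Lop_congr (β - σ) hn).eq_of_nhds
    rw [L1]
    simp only [this, cst]
    simp
  · rw [← integral_smul]
    obtain ⟨M, hM0, w', hw', hM⟩ := sys.K_growth hσ
    obtain ⟨D, hD⟩ := cut_bound U (β - σ) u
    apply tendsto_integral_of_dominated_convergence
      (fun s => M * D * Real.exp ((w' - σ.re) * s))
    · intro n
      exact (sys.integrable_K (q := Lop β (Lop β (fun s : ℝ => Complex.exp (-(σ * s)) • ((cut n s : ℂ) • u))))
        (Lop_contDiff _ (Lop_contDiff _ (ContDiff.smul (cexp_contDiff σ) (hcd n)))).continuous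
        (Lop_compact _ (Lop_compact _ (hcc n).smul_left))).aestronglyMeasurable
    · exact (integrableOn_exp_mul_Ioi (by linarith) 0).const_mul _
    · intro n
      filter_upwards [ae_restrict_mem measurableSet_Ioi] with s hs
      have hs' : 0 ≤ s := le_of_lt hs
      rw [L2]
      simp only [map_smul, norm_smul]
      have e1 : ‖Complex.exp (-(σ * s))‖ = Real.exp (-(σ.re * s)) := by
        rw [Complex.norm_exp]; simp
      rw [e1, sub_mul, sub_eq_add_neg (w' * s), Real.exp_add]
      have h1 := (sys.K s).le_opNorm (Lop (β - σ) (Lop (β - σ) (fun s => (cut n s : ℂ) • u)) s)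
      have h2 := hM s hs'
      have h3 := hD n s hs'
      calc _ ≤ Real.exp (-(σ.re * s)) * ((M * Real.exp (w' * s)) * D) := by
            gcongr
            exact h1.trans (mul_le_mul h2 h3 (norm_nonneg _) (by positivity))
        _ = _ := by ring
    · filter_upwards [ae_restrict_mem measurableSet_Ioi] with s hs
      have hs' : 0 ≤ s := le_of_lt hs
      apply tendsto_const_nhds.congr'
      filter_upwards [ev s hs'] with n hn
      have := (Lop_congr (β - σ) (Lop_congr (β - σ) hn)).eq_of_nhds
      rw [L2]
      simp only [this, cst]
      simp only [map_smul, smul_smul]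
      congr 1
      ring

theorem Phi_bound [FiniteDimensional ℂ U] [CompleteSpace X] [CompleteSpace Xm1] [CompleteSpace Y]
    (sys : SystemNode U X Xm1 Y) (h : sys.CInfBIBOStable) : ∃ c : ℝ, 0 < c ∧
    ∀ φ : ℝ → U, ContDiff ℝ (⊤ : ℕ∞) φ → HasCompactSupport φ → ∀ M : ℝ, (∀ s, ‖φ s‖ ≤ M) →
      ‖sys.Phi φ‖ ≤ c * M := by
  obtain ⟨c, hc, H⟩ := h
  refine ⟨c, hc, fun φ hφ hφc M hM => ?_⟩
  obtain ⟨t, ht⟩ := hφc.isCompact.bddAbove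
  set T := max t 0 + 1
  have hT : 0 ≤ T := by positivity
  have hu : ContDiff ℝ (⊤ : ℕ∞) (fun s => φ (T - s)) := hφ.comp (by fun_prop)
  have hs : tsupport (fun s => φ (T - s)) ⊆ Ioi 0 := by
    have : tsupport (fun s => φ (T - s)) ⊆ (fun s => T - s) ⁻¹' tsupport φ := by
      apply closure_minimal
      · intro s hs
        exact subset_tsupport _ hs
      · exact (isClosed_tsupport φ).preimage (by fun_prop)
    intro s hs
    have h1 := ht (this hs)
    have := le_max_left t 0
    simp only [mem_Ioi]
    simp only [T] at h1
    linarith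
  obtain ⟨h1, h2⟩ := sys.exists_sol hu (comp_sub_compact hφc T) hs
  have := H _ _ _ h1 h2 hu (comp_sub_compact hφc T) hs M (fun s => hM _) T hT
  simpa using this

end SystemNode

open MeasureTheory Set
open scoped ENNReal NNReal Topology

namespace SystemNode
variable {U X Xm1 Y : Type*}
  [NormedAddCommGroup U] [NormedSpace ℂ U]
  [NormedAddCommGroup X] [NormedSpace ℂ X]
  [NormedAddCommGroup Xm1] [NormedSpace ℂ Xm1]
  [NormedAddCommGroup Y] [NormedSpace ℂ Y]

open BoundedContinuousFunction in
theorem scalar_repr [FiniteDimensional ℂ U] [CompleteSpace X] [CompleteSpace Xm1] [CompleteSpace Y]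
    (sys : SystemNode U X Xm1 Y) (hB : sys.CInfBIBOStable) (ℓ : Y →L[ℂ] ℂ) (u : U) :
    ∃ (μ : Measure ℝ) (g : ℝ → ℂ), IsFiniteMeasure μ ∧ Integrable g μ ∧
      ∀ f : ℝ → ℂ, ContDiff ℝ (⊤ : ℕ∞) f → HasCompactSupport f →
        ℓ (sys.Phi (fun s => f s • u)) = ∫ x, f x * g x ∂μ := by
  obtain ⟨c, hc, hb⟩ := sys.Phi_bound hB
  let E : Submodule ℂ (ℝ →ᵇ ℂ) :=
    { carrier := {h | ContDiff ℝ (⊤ : ℕ∞) h ∧ HasCompactSupport h}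
      add_mem' := fun {a b} ha hb => ⟨ha.1.add hb.1, HasCompactSupport.add (f := a) (f' := b) ha.2 hb.2⟩
      zero_mem' := ⟨contDiff_const, HasCompactSupport.zero⟩
      smul_mem' := fun c h hh => ⟨hh.1.const_smul c, HasCompactSupport.mono (f := h) hh.2
        (fun s hs hx => hs (by simp [hx]))⟩ }
  have cd : ∀ f : E, ContDiff ℝ (⊤ : ℕ∞) (fun s => f.1 s • u) := fun f => f.2.1.smul contDiff_const
  have cc : ∀ f : E, HasCompactSupport (fun s => f.1 s • u) := fun f =>
    HasCompactSupport.mono f.2.2 (fun s hs hx => hs (by simp [hx]))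
  let L : E →ₗ[ℂ] ℂ :=
    { toFun := fun f => ℓ (sys.Phi (fun s => f.1 s • u))
      map_add' := fun f g => by
        have : (fun s => (f + g).1 s • u) = fun s => f.1 s • u + g.1 s • u := by
          funext s; simp [add_smul]
        rw [this, sys.Phi_add (cd f) (cd g) (cc f) (cc g), map_add]
      map_smul' := fun a f => by
        have : (fun s => (a • f).1 s • u) = fun s => a • (f.1 s • u) := by
          funext s; simp [smul_smul]
        rw [this, sys.Phi_smul a (cd f), map_smul]
        rfl }
  let L' : StrongDual ℂ E := L.mkContinuous (‖ℓ‖ * (c * ‖u‖)) (fun f => by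
    have h1 := hb _ (cd f) (cc f) (‖f.1‖ * ‖u‖) (fun s => by
      rw [norm_smul]
      exact mul_le_mul_of_nonneg_right (f.1.norm_coe_le_norm s) (norm_nonneg _))
    calc ‖L f‖ ≤ ‖ℓ‖ * ‖sys.Phi (fun s => f.1 s • u)‖ := ℓ.le_opNorm _
      _ ≤ ‖ℓ‖ * (c * (‖f.1‖ * ‖u‖)) := by gcongr
      _ = ‖ℓ‖ * (c * ‖u‖) * ‖f.1‖ := by ring)
  obtain ⟨Φ, hΦ, -⟩ := exists_extension_norm_eq E L'
  obtain ⟨μ, g, h1, h2, h3⟩ := riesz_scalar Φ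
  refine ⟨μ, g, h1, h2, fun f hf hfc => ?_⟩
  obtain ⟨C, hC⟩ := hfc.exists_bound_of_continuous hf.continuous
  let f' : ℝ →ᵇ ℂ := BoundedContinuousFunction.ofNormedAddCommGroup f hf.continuous C hC
  have e1 : Φ f' = ℓ (sys.Phi (fun s => f s • u)) := hΦ ⟨f', hf, hfc⟩
  rw [← e1]
  exact h3 f' hfc

theorem _root_.rn_combine {ι : Type*} [Fintype ι] (μ : ι → Measure ℝ) (g : ι → ℝ → ℂ)
    (hμ : ∀ k, IsFiniteMeasure (μ k)) (hg : ∀ k, Integrable (g k) (μ k)) :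
    ∃ (ν : Measure ℝ) (G : ι → ℝ → ℂ), IsFiniteMeasure ν ∧ (∀ k, Integrable (G k) ν) ∧
      ∀ k, ∀ f : ℝ → ℂ, ∫ x, f x * g k x ∂(μ k) = ∫ x, f x * G k x ∂ν := by
  have hac : ∀ k, μ k ≪ Measure.sum μ := fun k =>
    Measure.absolutelyContinuous_sum_right k Measure.AbsolutelyContinuous.rfl
  refine ⟨Measure.sum μ, fun k x => ((μ k).rnDeriv (Measure.sum μ) x).toReal • g k x, inferInstance,
    fun k => (integrable_rnDeriv_smul_iff (hac k)).2 (hg k), fun k f => ?_⟩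
  rw [← integral_rnDeriv_smul (hac k)]
  congr 1
  funext x
  simp only [mul_smul_comm]

theorem _root_.int_sum_smul {E ι : Type*} [NormedAddCommGroup E] [NormedSpace ℂ E] [Fintype ι]
    {ν : Measure ℝ} (G : ι → ℝ → ℂ) (hG : ∀ k, Integrable (G k) ν) (T : ι → E) :
    Integrable (fun x => ∑ k : ι, G k x • T k) ν := by
  apply integrable_finsetSum
  intro k _
  exact (hG k).smul_const (T k)

theorem _root_.mat_combine [FiniteDimensional ℂ U] [FiniteDimensional ℂ Y] {ι κ : Type*} [Fintype ι] [Fintype κ]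
    (bU : Module.Basis κ ℂ U) (bY : Module.Basis ι ℂ Y) (ν : Measure ℝ) (G : ι × κ → ℝ → ℂ)
    (hG : ∀ k, Integrable (G k) ν) :
    ∃ Γ : ℝ → U →L[ℂ] Y, Integrable Γ ν ∧ ∀ x i j, bY.coord i (Γ x (bU j)) = G (i, j) x := by
  classical
  have gen : ∀ T : ι × κ → U →L[ℂ] Y, Integrable (fun x => ∑ k : ι × κ, G k x • T k) ν := by
    intro T
    exact int_sum_smul G hG T
  refine ⟨fun x => ∑ k : ι × κ, G k x • (LinearMap.toContinuousLinearMap (bU.coord k.2)).smulRight (bY k.1),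
    gen _, fun x i j => ?_⟩
  simp only [ContinuousLinearMap.sum_apply, _root_.smul_apply,
      ContinuousLinearMap.smulRight_apply, map_sum, map_smul]
  rw [Finset.sum_eq_single (i, j)]
  · simp
  · intro k _ hk
    by_cases h1 : k.2 = j
    · have h2 : k.1 ≠ i := fun h2 => hk (Prod.ext h2 h1)
      simp [h2]
    · simp [Ne.symm h1]
  · simp

theorem op_repr [FiniteDimensional ℂ U] [CompleteSpace X] [CompleteSpace Xm1] [FiniteDimensional ℂ Y]
    (sys : SystemNode U X Xm1 Y) (hB : sys.CInfBIBOStable) :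
    ∃ (μ : Measure ℝ) (g : ℝ → U →L[ℂ] Y), IsFiniteMeasure μ ∧ Integrable g μ ∧
      ∀ f : ℝ → ℂ, ContDiff ℝ (⊤ : ℕ∞) f → HasCompactSupport f → ∀ u : U,
        sys.Phi (fun s => f s • u) = ∫ x, f x • g x u ∂μ := by
  have : CompleteSpace Y := FiniteDimensional.complete ℂ Y
  obtain ⟨ν, G, hν, hG, hrep⟩ : ∃ (ν : Measure ℝ)
      (G : Fin (Module.finrank ℂ Y) × Fin (Module.finrank ℂ U) → ℝ → ℂ), IsFiniteMeasure ν ∧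
      (∀ k, Integrable (G k) ν) ∧ ∀ k, ∀ f : ℝ → ℂ, ContDiff ℝ (⊤ : ℕ∞) f → HasCompactSupport f →
        (Module.finBasis ℂ Y).coord k.1 (sys.Phi (fun s => f s • Module.finBasis ℂ U k.2)) =
          ∫ x, f x * G k x ∂ν := by
    choose μ g hμ hg hrep using fun k : Fin (Module.finrank ℂ Y) × Fin (Module.finrank ℂ U) =>
      sys.scalar_repr hB (LinearMap.toContinuousLinearMap ((Module.finBasis ℂ Y).coord k.1))
        (Module.finBasis ℂ U k.2)
    obtain ⟨ν, G, h1, h2, h3⟩ := rn_combine μ g hμ hg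
    exact ⟨ν, G, h1, h2, fun k f hf hfc => (hrep k f hf hfc).trans (h3 k f)⟩
  generalize Module.finBasis ℂ U = bU at *
  generalize Module.finBasis ℂ Y = bY at *
  obtain ⟨Γ, hΓ, hΓG⟩ := mat_combine bU bY ν G hG
  refine ⟨ν, Γ, hν, hΓ, fun f hf hfc u => ?_⟩
  obtain ⟨C, hC⟩ := hfc.exists_bound_of_continuous hf.continuous
  have hint : ∀ u, Integrable (fun x => f x • Γ x u) ν := fun u =>
    (hΓ.apply_continuousLinearMap u).bdd_smul C
      hf.continuous.aestronglyMeasurable (Filter.Eventually.of_forall hC)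
  have cd : ∀ u : U, ContDiff ℝ (⊤ : ℕ∞) (fun s => f s • u) := fun u => hf.smul contDiff_const
  have cc : ∀ u : U, HasCompactSupport (fun s => f s • u) := fun u =>
    HasCompactSupport.mono hfc (fun s hs hx => hs (by simp [hx]))
  obtain ⟨L1, hL1⟩ : ∃ L1 : U →ₗ[ℂ] Y, ∀ u, L1 u = sys.Phi (fun s => f s • u) :=
   ⟨{ toFun := fun u => sys.Phi (fun s => f s • u)
      map_add' := fun u v => by
        have := sys.Phi_add (cd u) (cd v) (cc u) (cc v)
        rw [← this]
        simp only [smul_add]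
      map_smul' := fun a u => by
        have := sys.Phi_smul a (cd u)
        rw [RingHom.id_apply, ← this]
        congr 1
        funext s
        rw [smul_comm] }, fun u => rfl⟩
  obtain ⟨L2, hL2⟩ : ∃ L2 : U →ₗ[ℂ] Y, ∀ u, L2 u = ∫ x, f x • Γ x u ∂ν :=
   ⟨{ toFun := fun u => ∫ x, f x • Γ x u ∂ν
      map_add' := fun u v => by
        rw [← integral_add (hint u) (hint v)]
        simp only [map_add, smul_add]
      map_smul' := fun a u => by
        rw [RingHom.id_apply, ← integral_smul]
        congr 1
        funext x
        rw [map_smul, smul_comm] }, fun u => rfl⟩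
  rw [← hL1, ← hL2]
  suffices L1 = L2 by rw [this]
  apply bU.ext
  intro j
  apply bY.ext_elem
  intro i
  rw [hL1, hL2]
  have e1 := hrep (i, j) f hf hfc
  have e2 : LinearMap.toContinuousLinearMap (bY.coord i) (∫ x, f x • Γ x (bU j) ∂ν) =
      ∫ x, LinearMap.toContinuousLinearMap (bY.coord i) (f x • Γ x (bU j)) ∂ν :=
    (ContinuousLinearMap.integral_comp_comm _ (hint (bU j))).symm
  change bY.coord i (sys.Phi (fun s => f s • bU j)) =
    LinearMap.toContinuousLinearMap (bY.coord i) (∫ x, f x • Γ x (bU j) ∂ν)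
  rw [e2, e1]
  congr 1
  funext x
  rw [map_smul, smul_eq_mul, LinearMap.coe_toContinuousLinearMap', hΓG]

theorem forward [FiniteDimensional ℂ U] [CompleteSpace X] [CompleteSpace Xm1] [FiniteDimensional ℂ Y]
    (sys : SystemNode U X Xm1 Y) (hB : sys.CInfBIBOStable) :
    ∃ h : BVMeasure U Y, LaplaceMatches sys h := by
  have : CompleteSpace Y := FiniteDimensional.complete ℂ Y
  obtain ⟨ν, Γ, hν, hΓ, hrep⟩ := sys.op_repr hB
  let ρ := ν.restrict (Ici 0)
  have hΓρ : Integrable Γ ρ := hΓ.restrict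
  have hm : AEMeasurable (fun x => ‖Γ x‖₊) ρ := hΓρ.aestronglyMeasurable.nnnorm.aemeasurable
  let h : BVMeasure U Y :=
    { μ := ρ.withDensity (fun x => ((‖Γ x‖₊ : ℝ≥0) : ℝ≥0∞))
      finite := isFiniteMeasure_withDensity hΓρ.2.ne
      supported := by
        apply withDensity_absolutelyContinuous
        rw [Measure.restrict_apply measurableSet_Iio]
        have : Iio (0:ℝ) ∩ Ici 0 = ∅ := by ext x; simp
        rw [this, measure_empty]
      g := fun x => ((‖Γ x‖⁻¹ : ℝ) : ℂ) • Γ x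
      g_meas := by
        apply AEStronglyMeasurable.mono_ac (withDensity_absolutelyContinuous _ _)
        refine AEStronglyMeasurable.smul (f := fun x => ((‖Γ x‖⁻¹ : ℝ) : ℂ)) ?_ hΓρ.aestronglyMeasurable
        exact (Complex.measurable_ofReal.comp_aemeasurable
          hΓρ.aestronglyMeasurable.norm.aemeasurable.inv).aestronglyMeasurable
      g_norm := by
        rw [ae_withDensity_iff' hm.coe_nnreal_ennreal]
        refine Filter.Eventually.of_forall (fun x hx => ?_)
        have hx' : ‖Γ x‖ ≠ 0 := by simpa using hx
        rw [norm_smul, Complex.norm_real, norm_inv, norm_norm, inv_mul_cancel₀ hx'] }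
  refine ⟨h, fun σ hσ hσ0 u => ?_⟩
  have e1 : h.laplace σ u = ∫ t in Ici (0:ℝ), Complex.exp (-(σ * t)) • Γ t u ∂ν := by
    have := integral_withDensity_eq_integral_smul₀ hm
      (fun t : ℝ => Complex.exp (-(σ * t)) • (((‖Γ t‖⁻¹ : ℝ) : ℂ) • Γ t) u)
    refine Eq.trans this ?_
    apply integral_congr_ae
    refine Filter.Eventually.of_forall (fun t => ?_)
    simp only [_root_.smul_apply]
    by_cases hz : Γ t = 0
    · simp [hz]
    · have hz' : (‖Γ t‖ : ℂ) ≠ 0 := by simpa using hz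
      rw [NNReal.smul_def, coe_nnnorm, smul_comm, ← Complex.coe_smul (‖Γ t‖), smul_smul, smul_smul,
        Complex.ofReal_inv, mul_assoc, mul_inv_cancel₀ hz', mul_one]
  rw [e1, ← integral_indicator measurableSet_Ici]
  refine tendsto_nhds_unique ?_ (sys.Phi_tendsto hσ u)
  have e2 : ∀ n, sys.Phi (fun s : ℝ => Complex.exp (-(σ * s)) • ((cut n s : ℂ) • u)) =
      ∫ t, (Complex.exp (-(σ * t)) * (cut n t : ℂ)) • Γ t u ∂ν := by
    intro n
    rw [← hrep (fun t : ℝ => Complex.exp (-(σ * t)) * (cut n t : ℂ))]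
    · simp only [mul_smul]
    · exact (cexp_contDiff σ).mul (Complex.ofRealCLM.contDiff.comp (cut_contDiff n))
    · exact (cut_compact n).mono (fun s hs hx => hs (by simp [hx]))
  simp only [e2]
  have hΓu := hΓ.apply_continuousLinearMap u
  apply tendsto_integral_of_dominated_convergence (fun t => Real.exp (2 * σ.re) * ‖Γ t u‖)
  · intro n
    apply AEStronglyMeasurable.smul _ hΓu.aestronglyMeasurable
    exact ((cexp_contDiff σ).continuous.mul
      (Complex.continuous_ofReal.comp (cut_contDiff n).continuous)).aestronglyMeasurable
  · exact hΓu.norm.const_mul _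
  · intro n
    refine Filter.Eventually.of_forall (fun t => ?_)
    rw [norm_smul]
    gcongr
    rw [norm_mul, Complex.norm_real, Real.norm_of_nonneg (cut_nonneg n t)]
    by_cases ht : t ≤ -2
    · rw [cut_zero n ht, mul_zero]; positivity
    · calc _ ≤ ‖Complex.exp (-(σ * t))‖ * 1 := by gcongr; exact cut_le_one n t
        _ ≤ _ := by
          rw [mul_one, Complex.norm_exp]
          apply Real.exp_le_exp.2
          simp
          push Not at ht
          nlinarith
  · refine Filter.Eventually.of_forall (fun t => ?_)
    apply tendsto_const_nhds.congr'
    by_cases ht : 0 ≤ t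
    · filter_upwards [cut_one ht] with n hn
      have := hn.eq_of_nhds
      rw [this, indicator_of_mem (by exact ht)]
      simp
    · push Not at ht
      filter_upwards [cut_tendsto_neg ht] with n hn
      rw [hn, indicator_of_notMem (by simpa using ht)]
      simp

end SystemNode

open MeasureTheory Set
open scoped ENNReal NNReal Topology

/-- vertical line -/
noncomputable def sgm (a ξ : ℝ) : ℂ := a - 2 * Real.pi * ξ * Complex.I

open FourierTransform in
/-- Fourier density -/
noncomputable def kF {E : Type*} [NormedAddCommGroup E] [NormedSpace ℂ E] (a : ℝ) (φ : ℝ → E) : ℝ → E :=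
  𝓕 (fun s : ℝ => Complex.exp (-((-(a:ℂ)) * s)) • φ s)

theorem cexp_sgm (a ξ s : ℝ) : Complex.exp (-(sgm a ξ * s)) =
    Complex.exp (((2 * Real.pi * (ξ * s) : ℝ) : ℂ) * Complex.I) * Complex.exp (-((a:ℂ) * s)) := by
  rw [← Complex.exp_add]
  congr 1
  unfold sgm
  push_cast
  ring

open FourierTransform in
theorem kF_spec {E : Type*} [NormedAddCommGroup E] [NormedSpace ℂ E] [CompleteSpace E] (a : ℝ) {φ : ℝ → E}
    (h : ContDiff ℝ (⊤ : ℕ∞) φ) (hc : HasCompactSupport φ) :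
    Integrable (kF a φ) ∧ ∀ s, φ s = ∫ ξ : ℝ, Complex.exp (-(sgm a ξ * s)) • kF a φ ξ := by
  have h1 : ContDiff ℝ (⊤ : ℕ∞) (fun s : ℝ => Complex.exp (-((-(a:ℂ)) * s)) • φ s) :=
    (cexp_contDiff _).smul h
  have h2 : HasCompactSupport (fun s : ℝ => Complex.exp (-((-(a:ℂ)) * s)) • φ s) :=
    hc.mono (fun s hs hx => hs (by simp [hx]))
  have hI : Integrable (kF a φ) := by
    have := (𝓕 (h2.toSchwartzMap h1)).integrable (μ := volume)
    rw [SchwartzMap.fourier_coe] at this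
    exact this
  refine ⟨hI, fun s => ?_⟩
  have h3 := congrFun (Continuous.fourierInv_fourier_eq h1.continuous
    (h1.continuous.integrable_of_hasCompactSupport h2) hI) s
  rw [Real.fourierInv_eq'] at h3
  have h4 : φ s = Complex.exp (-((a:ℂ) * s)) • (Complex.exp (-((-(a:ℂ)) * s)) • φ s) := by
    rw [smul_smul, ← Complex.exp_add]
    simp
  rw [h4, ← h3, ← integral_smul]
  congr 1
  funext ξ
  rw [cexp_sgm, smul_smul, mul_comm]
  simp only [kF]
  congr 4
  simp [mul_comm]

open FourierTransform in
theorem kF_Lop {E : Type*} [NormedAddCommGroup E] [NormedSpace ℂ E] [CompleteSpace E] (β : ℂ) (a : ℝ) {φ : ℝ → E}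
    (h : ContDiff ℝ (⊤ : ℕ∞) φ) (hc : HasCompactSupport φ) (ξ : ℝ) :
    kF a (Lop β φ) ξ = (β - sgm a ξ) • kF a φ ξ := by
  have h1 : ContDiff ℝ (⊤ : ℕ∞) (fun s : ℝ => Complex.exp (-((-(a:ℂ)) * s)) • φ s) :=
    (cexp_contDiff _).smul h
  have h2 : HasCompactSupport (fun s : ℝ => Complex.exp (-((-(a:ℂ)) * s)) • φ s) :=
    hc.mono (fun s hs hx => hs (by simp [hx]))
  have h3 := Lop_exp (β - a) (-(a:ℂ)) (h.differentiable (by simp))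
  rw [sub_neg_eq_add, sub_add_cancel] at h3
  unfold kF
  rw [← h3]
  generalize hψ : (fun s : ℝ => Complex.exp (-((-(a:ℂ)) * s)) • φ s) = ψ at *
  have hd : Continuous (deriv ψ) := (contDiff_infty_iff_deriv.1 h1).2.continuous
  have i1 : Integrable ψ := h1.continuous.integrable_of_hasCompactSupport h2
  have i2 : Integrable (deriv ψ) := hd.integrable_of_hasCompactSupport h2.deriv
  have h5 := congrFun (Real.fourier_deriv i1 (h1.differentiable (by simp)) i2) ξ
  have h6 : 𝓕 (Lop (β - a) ψ) ξ = (β - a) • 𝓕 ψ ξ + 𝓕 (deriv ψ) ξ := by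
    rw [Real.fourier_real_eq, Real.fourier_real_eq, Real.fourier_real_eq, ← integral_smul, ← integral_add]
    · congr 1
      funext v
      unfold Lop
      rw [smul_add, smul_comm]
    · exact ((Real.fourierIntegral_convergent_iff ξ).2 i1 |>.smul (β - (a:ℂ)) |>.congr (by
        filter_upwards with v
        simp [mul_comm]))
    · exact ((Real.fourierIntegral_convergent_iff ξ).2 i2 |>.congr (by
        filter_upwards with v
        simp [mul_comm]))
  rw [h6, h5, ← add_smul]
  congr 1
  unfold sgm
  ring

theorem swapF {E F : Type*} [NormedAddCommGroup E] [NormedSpace ℂ E] [CompleteSpace E]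
    [NormedAddCommGroup F] [NormedSpace ℂ F] [CompleteSpace F] {ρ : Measure ℝ} [SFinite ρ] (a : ℝ)
    {L : ℝ → E →L[ℂ] F} (hL : Integrable (fun t : ℝ => Complex.exp (-((a:ℂ) * t)) • L t) ρ)
    {k : ℝ → E} (hk : Integrable k) :
    Integrable (fun ξ => ∫ t, Complex.exp (-(sgm a ξ * t)) • L t (k ξ) ∂ρ) ∧
    ∫ t, L t (∫ ξ, Complex.exp (-(sgm a ξ * t)) • k ξ) ∂ρ =
      ∫ ξ, ∫ t, Complex.exp (-(sgm a ξ * t)) • L t (k ξ) ∂ρ := by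
  have hp : Integrable (fun z : ℝ × ℝ => (Complex.exp (-((a:ℂ) * z.1)) • L z.1) (k z.2)) (ρ.prod volume) :=
    hL.op_fst_snd (op := fun (A : E →L[ℂ] F) (v : E) => A v)
      (isBoundedBilinearMap_apply.continuous) ⟨1, fun A v => by simpa using A.le_opNorm v⟩ hk
  have hq : Integrable (fun z : ℝ × ℝ => Complex.exp (-(sgm a z.2 * z.1)) • L z.1 (k z.2)) (ρ.prod volume) := by
    have := hp.bdd_smul (φ := fun z : ℝ × ℝ => Complex.exp (((2 * Real.pi * (z.2 * z.1) : ℝ) : ℂ) * Complex.I)) 1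
      (by
        apply Continuous.aestronglyMeasurable
        fun_prop) (Filter.Eventually.of_forall fun z => by
        rw [Complex.norm_exp_ofReal_mul_I])
    refine this.congr (Filter.Eventually.of_forall fun z => ?_)
    simp only [cexp_sgm, ContinuousLinearMap.smul_apply, smul_smul, Pi.smul_apply']
  refine ⟨hq.integral_prod_right, ?_⟩
  rw [← integral_integral_swap (f := fun (t ξ : ℝ) => Complex.exp (-(sgm a ξ * t)) • L t (k ξ)) hq]
  congr 1
  funext t
  rw [← ContinuousLinearMap.integral_comp_comm]
  · simp
  · have := hk.bdd_smul (φ := fun ξ : ℝ => Complex.exp (-(sgm a ξ * t))) ‖Complex.exp (-((a:ℂ) * t))‖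
      (by
        apply Continuous.aestronglyMeasurable
        unfold sgm
        fun_prop) (Filter.Eventually.of_forall fun ξ => by
        rw [cexp_sgm, norm_mul, Complex.norm_exp_ofReal_mul_I, one_mul])
    exact this

namespace SystemNode
variable {U X Xm1 Y : Type*}
  [NormedAddCommGroup U] [NormedSpace ℂ U]
  [NormedAddCommGroup X] [NormedSpace ℂ X]
  [NormedAddCommGroup Xm1] [NormedSpace ℂ Xm1]
  [NormedAddCommGroup Y] [NormedSpace ℂ Y]

theorem K_expInt [FiniteDimensional ℂ U] [CompleteSpace X]
    (sys : SystemNode U X Xm1 Y) {a : ℝ} (ha : sys.S.growthBound < a) :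
    Integrable (fun t : ℝ => Complex.exp (-((a:ℂ) * t)) • sys.K t) (volume.restrict (Ioi 0)) := by
  obtain ⟨M, hM, w', hw, hK⟩ := sys.K_growth ha
  have h0 : IntegrableOn (fun t : ℝ => M * Real.exp ((w' - a) * t)) (Ioi 0) :=
    (integrableOn_exp_mul_Ioi (by linarith) 0).const_mul M
  refine Integrable.mono' h0 ?_ ?_
  · have : Continuous (fun t : ℝ => Complex.exp (-((a:ℂ) * t)) • sys.K (max t 0)) :=
      ((cexp_contDiff (a:ℂ)).continuous).smul sys.continuous_K
    refine this.aestronglyMeasurable.congr ?_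
    filter_upwards [ae_restrict_mem measurableSet_Ioi] with t ht
    rw [max_eq_left (le_of_lt ht)]
  · filter_upwards [ae_restrict_mem measurableSet_Ioi] with t ht
    rw [norm_smul, Complex.norm_exp]
    have := hK t (le_of_lt ht)
    calc _ ≤ Real.exp (-(a * t)) * (M * Real.exp (w' * t)) := by
          have e : (-((a:ℂ) * t)).re = -(a * t) := by simp
          rw [e]
          gcongr
      _ = M * Real.exp ((w' - a) * t) := by
          rw [mul_left_comm, ← Real.exp_add]
          ring_nf

theorem sgm_re (a ξ : ℝ) : (sgm a ξ).re = a := by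
  simp [sgm]

theorem Phi_fourier [FiniteDimensional ℂ U] [CompleteSpace X] [CompleteSpace Xm1] [CompleteSpace Y]
    (sys : SystemNode U X Xm1 Y) {a : ℝ} (ha : sys.S.growthBound < a) {φ : ℝ → U}
    (h : ContDiff ℝ (⊤ : ℕ∞) φ) (hc : HasCompactSupport φ) :
    sys.Phi φ = ∫ ξ, sys.G (sgm a ξ) (kF a φ ξ) := by
  have : CompleteSpace U := FiniteDimensional.complete ℂ U
  obtain ⟨i0, e0⟩ := kF_spec a h hc
  have hL := Lop_contDiff sys.betaPt h
  have hLc := Lop_compact sys.betaPt hc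
  obtain ⟨i1, e1⟩ := kF_spec a hL hLc
  obtain ⟨i2, e2⟩ := kF_spec a (Lop_contDiff sys.betaPt hL) (Lop_compact sys.betaPt hLc)
  obtain ⟨i3, e3⟩ := swapF a (sys.K_expInt ha) i2
  unfold Phi
  rw [e0 0, e1 0]
  simp only [Complex.ofReal_zero, mul_zero, neg_zero, Complex.exp_zero, one_smul]
  rw [← ContinuousLinearMap.integral_comp_comm _ i0, ← ContinuousLinearMap.integral_comp_comm _ i1]
  rw [integral_congr_ae (μ := volume.restrict (Ioi 0)) (Filter.Eventually.of_forall fun s => by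
    show sys.K s (Lop sys.betaPt (Lop sys.betaPt φ) s) = sys.K s (∫ ξ : ℝ, Complex.exp (-(sgm a ξ * s)) • kF a (Lop sys.betaPt (Lop sys.betaPt φ)) ξ)
    rw [e2 s]), e3]
  have j0 : Integrable (fun ξ => sys.G sys.betaPt (kF a φ ξ)) := ContinuousLinearMap.integrable_comp _ i0
  have j1 : Integrable (fun ξ => sys.K 0 (kF a (Lop sys.betaPt φ) ξ)) :=
    ContinuousLinearMap.integrable_comp _ i1
  have j2 : Integrable (fun ξ => sys.G sys.betaPt (kF a φ ξ) + sys.K 0 (kF a (Lop sys.betaPt φ) ξ)) :=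
    j0.add j1
  rw [← integral_add j0 j1, ← integral_add j2 i3]
  congr 1
  funext ξ
  rw [(sys.G_formula (σ := sgm a ξ) (by rw [sgm_re]; exact ha) _).2]
  rw [kF_Lop _ _ hL hLc, kF_Lop _ _ h hc, map_smul]
  congr 1
  rw [← integral_smul]
  congr 1
  funext s
  rw [map_smul, map_smul, smul_smul, smul_smul, smul_smul]
  congr 1
  ring

theorem Phi_measure [FiniteDimensional ℂ U] [CompleteSpace X] [CompleteSpace Xm1] [CompleteSpace Y]
    (sys : SystemNode U X Xm1 Y) (h : BVMeasure U Y) (hh : LaplaceMatches sys h) {φ : ℝ → U}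
    (hφ : ContDiff ℝ (⊤ : ℕ∞) φ) (hc : HasCompactSupport φ) :
    sys.Phi φ = ∫ t, h.g t (φ t) ∂h.μ := by
  have : CompleteSpace U := FiniteDimensional.complete ℂ U
  have := h.finite
  obtain ⟨a, ha1, ha2⟩ : ∃ a : ℝ, sys.S.growthBound < a ∧ 0 ≤ a :=
    ⟨max sys.S.growthBound 0 + 1, by linarith [le_max_left sys.S.growthBound 0],
      by linarith [le_max_right sys.S.growthBound 0]⟩
  obtain ⟨i0, e0⟩ := kF_spec a hφ hc
  have hpos : ∀ᵐ t ∂h.μ, 0 ≤ t := by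
    rw [ae_iff]
    simpa [Iio] using h.supported
  have hg : Integrable (fun t : ℝ => Complex.exp (-((a:ℂ) * t)) • h.g t) h.μ := by
    refine Integrable.mono' (integrable_const (1:ℝ)) ?_ ?_
    · exact AEStronglyMeasurable.smul (cexp_contDiff (a:ℂ)).continuous.aestronglyMeasurable h.g_meas
    · filter_upwards [hpos, h.g_norm] with t ht hn
      rw [norm_smul, hn, mul_one, Complex.norm_exp, Real.exp_le_one_iff]
      have := mul_nonneg ha2 ht
      simpa using this
  obtain ⟨-, e3⟩ := swapF a hg i0
  rw [sys.Phi_fourier ha1 hφ hc]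
  rw [integral_congr_ae (μ := h.μ) (Filter.Eventually.of_forall fun t => by
    show h.g t (φ t) = h.g t (∫ ξ : ℝ, Complex.exp (-(sgm a ξ * t)) • kF a φ ξ)
    rw [← e0 t]), e3]
  congr 1
  funext ξ
  exact (hh (sgm a ξ) (by rw [sgm_re]; exact ha1) (by rw [sgm_re]; exact ha2) _).symm

theorem backward [FiniteDimensional ℂ U] [CompleteSpace X] [CompleteSpace Xm1] [CompleteSpace Y]
    (sys : SystemNode U X Xm1 Y) (h : BVMeasure U Y) (hh : LaplaceMatches sys h) :
    sys.CInfBIBOStable := by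
  have := h.finite
  refine ⟨h.μ.real univ + 1, by positivity, fun u x y hsol h0 hu hc hs M hM t ht => ?_⟩
  have hM0 : 0 ≤ M := (norm_nonneg _).trans (hM 0)
  rw [sys.output_eq hu hc hs hsol h0 ht,
    sys.Phi_measure h hh (φ := fun s => u (t - s)) (hu.comp (contDiff_const.sub contDiff_id)) (comp_sub_compact hc t)]
  have := norm_integral_le_of_norm_le_const (μ := h.μ) (f := fun s => h.g s (u (t - s))) (C := M) (by
    filter_upwards [h.g_norm] with s hn
    calc _ ≤ ‖h.g s‖ * ‖u (t - s)‖ := ContinuousLinearMap.le_opNorm _ _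
      _ ≤ M := by rw [hn, one_mul]; exact hM _)
  refine this.trans ?_
  nlinarith

end SystemNode

/-- Theorem 3.4: a system node with finite-dimensional input and output
spaces is `C^∞`-BIBO stable iff there is a measure of bounded total variation `h` on
`[0,∞)` with values in the `d_Y × d_U` matrices (i.e. in `L(U,Y)`) whose Laplace
transform equals the transfer function on the half-plane `ℂ_{ω(T)}`. -/
theorem cInfBIBO_iff_exists_bvMeasure
    {U X Xm1 Y : Type*}
    [NormedAddCommGroup U] [NormedSpace ℂ U] [FiniteDimensional ℂ U]
    [NormedAddCommGroup X] [NormedSpace ℂ X] [CompleteSpace X]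
    [NormedAddCommGroup Xm1] [NormedSpace ℂ Xm1] [CompleteSpace Xm1]
    [NormedAddCommGroup Y] [NormedSpace ℂ Y] [FiniteDimensional ℂ Y]
    (sys : SystemNode U X Xm1 Y) :
    sys.CInfBIBOStable ↔ ∃ h : BVMeasure U Y, LaplaceMatches sys h := by
  constructor
  · exact sys.forward
  · rintro ⟨h, hh⟩
    have : CompleteSpace Y := FiniteDimensional.complete ℂ Y
    exact sys.backward h hh
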